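/- arXiv:2512.15392 — 7 statements merged into one kernel-verified Lean document; each statement's English description precedes it below -/
import Mathlib

section
/- For every ε > 0 it holds ‖x_ε‖ ≤ ‖x*‖. -/
open Set

/-- For every ε > 0 it holds `‖x_ε‖ ≤ ‖x*‖`, where `x_ε` is the unique solution of
`∇f(x_ε) + ε x_ε = 0` and `x*` is the minimum norm minimizer of `f`. -/
theorem tikhonov_norm_le_min_norm_solution
    {H : Type*} [NormedAddCommGroup H] [InnerProductSpace ℝ H] [CompleteSpace H]
    (f : H → ℝ) (f' : H → H) (L : ℝ) (hL : 0 < L)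
    (hconv : ConvexOn ℝ Set.univ f)
    (hgrad : ∀ x : H, HasGradientAt f (f' x) x)
    (hlip : ∀ x y : H, ‖f' x - f' y‖ ≤ L * ‖x - y‖)
    (xstar : H) (hxstar : ∀ y : H, f xstar ≤ f y)
    (hxstar_min : ∀ y : H, (∀ z : H, f y ≤ f z) → ‖xstar‖ ≤ ‖y‖)
    (xe : ℝ → H) (hxe : ∀ ε : ℝ, 0 < ε → f' (xe ε) + ε • xe ε = 0) :
    ∀ ε : ℝ, 0 < ε → ‖xe ε‖ ≤ ‖xstar‖ := by
  intro ε hε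
  set x := xe ε with hx
  have h1 : f' x = -(ε • x) := eq_neg_of_add_eq_zero_left (hxe ε hε)
  have hline : HasDerivAt (fun t : ℝ => AffineMap.lineMap x xstar t) (xstar - x) (0 : ℝ) :=
    AffineMap.hasDerivAt_lineMap
  have hd : HasDerivAt (fun t : ℝ => f (AffineMap.lineMap x xstar t))
      (inner ℝ (f' x) (xstar - x)) (0 : ℝ) := by
    have hf : HasFDerivAt f (InnerProductSpace.toDual ℝ H (f' x))
        (AffineMap.lineMap x xstar (0 : ℝ)) := by
      rw [AffineMap.lineMap_apply_zero]
      exact (hgrad x).hasFDerivAt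
    have := hf.comp_hasDerivAt (0 : ℝ) hline
    simpa [Function.comp_def] using this
  have hc : ConvexOn ℝ Set.univ (fun t : ℝ => f (AffineMap.lineMap x xstar t)) := by
    have := hconv.comp_affineMap (AffineMap.lineMap x xstar : ℝ →ᵃ[ℝ] H)
    simpa [Function.comp_def] using this
  have h2 := hc.le_slope_of_hasDerivAt (Set.mem_univ 0) (Set.mem_univ 1) zero_lt_one hd
  simp only [slope_def_field, AffineMap.lineMap_apply_zero, AffineMap.lineMap_apply_one] at h2
  have h3 := hxstar x
  have h4 : inner ℝ (f' x) (xstar - x) = ε * (‖x‖ ^ 2 - inner ℝ x xstar) := by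
    rw [h1, inner_neg_left, inner_smul_left, inner_sub_right, real_inner_self_eq_norm_sq]
    simp
    ring
  have h5 : ε * (‖x‖ ^ 2 - inner ℝ x xstar) ≤ 0 := by
    rw [← h4]; linarith
  have h6 : ‖x‖ ^ 2 - inner ℝ x xstar ≤ 0 := nonpos_of_mul_nonpos_right h5 hε
  have h7 := real_inner_le_norm x xstar
  by_contra! h
  nlinarith [norm_nonneg x, norm_nonneg xstar]
end

section
/- For all ε₁, ε₂ > 0 one has ε₁‖x_{ε₁} − x_{ε₂}‖ ≤ |ε₁ − ε₂| · ‖x_{ε₂}‖; consequently ‖x_{ε₁} − x_{ε₂}‖ ≤ (|ε₁ − ε₂|/ε₁)‖x*‖. In particular, for any continuously differentiable ε : [t₀,∞) → (0,∞), the map t ↦ x_{ε(t)} is Lipschitz continuous on every compact subinterval of [t₀,∞). -/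
open Set

theorem grad_ineq_aux {H : Type*} [NormedAddCommGroup H] [InnerProductSpace ℝ H]
    [CompleteSpace H] (f : H → ℝ) (f' : H → H)
    (hconv : ConvexOn ℝ Set.univ f)
    (hgrad : ∀ x : H, HasGradientAt f (f' x) x) (x y : H) :
    f x + inner ℝ (f' x) (y - x) ≤ f y := by
  have hg : ConvexOn ℝ Set.univ (fun t : ℝ => f (AffineMap.lineMap x y t)) := by
    exact hconv.comp_affineMap (AffineMap.lineMap x y : ℝ →ᵃ[ℝ] H)
  have hd : HasDerivAt (fun t : ℝ => f (AffineMap.lineMap x y t))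
      (inner ℝ (f' x) (y - x)) 0 := by
    have h1 : HasFDerivAt f (InnerProductSpace.toDual ℝ H (f' x))
        (AffineMap.lineMap x y (0 : ℝ)) := by
      simpa using (hgrad x).hasFDerivAt
    have h2 : HasDerivAt (fun t : ℝ => (AffineMap.lineMap x y t : H)) (y - x) 0 :=
      AffineMap.hasDerivAt_lineMap
    exact h1.comp_hasDerivAt (0 : ℝ) h2
  have h := hg.le_slope_of_hasDerivAt (Set.mem_univ 0) (Set.mem_univ 1) one_pos hd
  simp [slope_def_field] at h
  linarith

/-- For all `ε₁, ε₂ > 0` one has `ε₁‖x_{ε₁} − x_{ε₂}‖ ≤ |ε₁ − ε₂|·‖x_{ε₂}‖`, hence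
`‖x_{ε₁} − x_{ε₂}‖ ≤ (|ε₁ − ε₂|/ε₁)‖x*‖`; consequently, for any continuously
differentiable positive parameter function `ε` on `[t₀,∞)`, the map `t ↦ x_{ε(t)}` is
Lipschitz continuous on every compact subinterval of `[t₀,∞)`. -/
theorem tikhonov_curve_lipschitz
    {H : Type*} [NormedAddCommGroup H] [InnerProductSpace ℝ H] [CompleteSpace H]
    (f : H → ℝ) (f' : H → H) (L : ℝ) (hL : 0 < L)
    (hconv : ConvexOn ℝ Set.univ f)
    (hgrad : ∀ x : H, HasGradientAt f (f' x) x)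
    (hlip : ∀ x y : H, ‖f' x - f' y‖ ≤ L * ‖x - y‖)
    (xstar : H) (hxstar : ∀ y : H, f xstar ≤ f y)
    (hxstar_min : ∀ y : H, (∀ z : H, f y ≤ f z) → ‖xstar‖ ≤ ‖y‖)
    (xe : ℝ → H) (hxe : ∀ ε : ℝ, 0 < ε → f' (xe ε) + ε • xe ε = 0) :
    (∀ ε₁ ε₂ : ℝ, 0 < ε₁ → 0 < ε₂ →
      ε₁ * ‖xe ε₁ - xe ε₂‖ ≤ |ε₁ - ε₂| * ‖xe ε₂‖ ∧
      ‖xe ε₁ - xe ε₂‖ ≤ (|ε₁ - ε₂| / ε₁) * ‖xstar‖) ∧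
    (∀ (t₀ : ℝ) (e : ℝ → ℝ), (∀ t ∈ Set.Ici t₀, 0 < e t) →
      ContDiffOn ℝ 1 e (Set.Ici t₀) →
      ∀ a b : ℝ, t₀ ≤ a →
        ∃ K : NNReal, LipschitzOnWith K (fun t => xe (e t)) (Set.Icc a b)) := by
  have key := grad_ineq_aux f f' hconv hgrad
  have hf' : ∀ ε : ℝ, 0 < ε → f' (xe ε) = -(ε • xe ε) := fun ε h =>
    eq_neg_of_add_eq_zero_left (hxe ε h)
  have hbd : ∀ ε : ℝ, 0 < ε → ‖xe ε‖ ≤ ‖xstar‖ := by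
    intro ε hε
    have h1 := key (xe ε) xstar
    have h2 := hxstar (xe ε)
    rw [hf' ε hε, inner_neg_left, inner_smul_left, inner_sub_right,
      real_inner_self_eq_norm_sq] at h1
    simp only [conj_trivial] at h1
    have h3 := real_inner_le_norm (xe ε) xstar
    have h4 : ‖xe ε‖ ^ 2 ≤ inner ℝ (xe ε) xstar := by
      have : 0 ≤ ε * (inner ℝ (xe ε) xstar - ‖xe ε‖ ^ 2) := by linarith
      have := nonneg_of_mul_nonneg_right this hε
      linarith
    by_contra! hlt
    have := norm_nonneg xstar
    nlinarith
  have main : ∀ ε₁ ε₂ : ℝ, 0 < ε₁ → 0 < ε₂ →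
      ε₁ * ‖xe ε₁ - xe ε₂‖ ≤ |ε₁ - ε₂| * ‖xe ε₂‖ ∧
      ‖xe ε₁ - xe ε₂‖ ≤ (|ε₁ - ε₂| / ε₁) * ‖xstar‖ := by
    intro ε₁ ε₂ h₁ h₂
    have hA : ε₁ * ‖xe ε₁ - xe ε₂‖ ≤ |ε₁ - ε₂| * ‖xe ε₂‖ := by
      have k1 := key (xe ε₁) (xe ε₂)
      have k2 := key (xe ε₂) (xe ε₁)
      rw [hf' _ h₁, ← neg_sub (xe ε₁) (xe ε₂), inner_neg_neg] at k1
      rw [hf' _ h₂, inner_neg_left] at k2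
      have e1 : ε₁ • xe ε₁ = ε₁ • (xe ε₁ - xe ε₂) + ε₁ • xe ε₂ := by
        rw [← smul_add, sub_add_cancel]
      rw [e1, inner_add_left] at k1
      simp only [inner_smul_left, conj_trivial, real_inner_self_eq_norm_sq] at k1 k2
      have h3 : |(ε₁ - ε₂) * inner ℝ (xe ε₂) (xe ε₁ - xe ε₂)|
          ≤ |ε₁ - ε₂| * (‖xe ε₂‖ * ‖xe ε₁ - xe ε₂‖) := by
        rw [abs_mul]
        exact mul_le_mul_of_nonneg_left (abs_real_inner_le_norm _ _) (abs_nonneg _)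
      have h4 := neg_abs_le ((ε₁ - ε₂) * inner ℝ (xe ε₂) (xe ε₁ - xe ε₂))
      rcases (norm_nonneg (xe ε₁ - xe ε₂)).eq_or_lt with h0 | h0
      · rw [← h0]; simp; positivity
      · refine le_of_mul_le_mul_right ?_ h0
        nlinarith
    refine ⟨hA, ?_⟩
    rw [div_mul_eq_mul_div, le_div_iff₀ h₁, mul_comm]
    exact hA.trans (mul_le_mul_of_nonneg_left (hbd _ h₂) (abs_nonneg _))
  refine ⟨main, ?_⟩
  intro t₀ e he hc a b ha
  rcases (Set.Icc a b).eq_empty_or_nonempty with hE | hne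
  · exact ⟨0, by rw [hE]; simp⟩
  have hsub : Set.Icc a b ⊆ Set.Ici t₀ := fun t ht => ha.trans ht.1
  have hc' := hc.mono hsub
  obtain ⟨K, hK⟩ := hc'.exists_lipschitzOnWith one_ne_zero (convex_Icc a b) isCompact_Icc
  obtain ⟨c, hcm, hmin⟩ := isCompact_Icc.exists_isMinOn hne hc'.continuousOn
  have hpos := he c (hsub hcm)
  refine ⟨⟨K / e c * ‖xstar‖, by positivity⟩, LipschitzOnWith.of_dist_le_mul ?_⟩
  intro s hs t ht
  have h1 := (main (e s) (e t) (he s (hsub hs)) (he t (hsub ht))).2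
  have h2 := hK.dist_le_mul s hs t ht
  have h3 : e c ≤ e s := hmin hs
  rw [Real.dist_eq] at h2
  rw [dist_eq_norm]
  change _ ≤ (K / e c * ‖xstar‖ : ℝ) * _
  calc _ ≤ _ := h1
    _ ≤ (K * dist s t / e c) * ‖xstar‖ := by gcongr
    _ = _ := by ring
end

section
/- Let ε : [t₀,∞) → (0,∞) be continuously differentiable and suppose the map t ↦ x_{ε(t)} is differentiable at a point t ≥ t₀. Then the value function t ↦ φ_{ε(t)}(x_{ε(t)}) is differentiable at t with derivative (d/dt)[φ_{ε(t)}(x_{ε(t)})] = (1/2) ε'(t) ‖x_{ε(t)}‖². -/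
open Set

/-- Derivative of the value function: if `t ↦ x_{ε(t)}` is differentiable at `t`, then
`t ↦ φ_{ε(t)}(x_{ε(t)})` is differentiable at `t` with derivative
`(1/2) ε'(t) ‖x_{ε(t)}‖²`. -/
theorem deriv_value_function
    {H : Type*} [NormedAddCommGroup H] [InnerProductSpace ℝ H] [CompleteSpace H]
    (f : H → ℝ) (f' : H → H) (L : ℝ) (hL : 0 < L)
    (hconv : ConvexOn ℝ Set.univ f)
    (hgrad : ∀ x : H, HasGradientAt f (f' x) x)
    (hlip : ∀ x y : H, ‖f' x - f' y‖ ≤ L * ‖x - y‖)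
    (xe : ℝ → H) (hxe : ∀ ε : ℝ, 0 < ε → f' (xe ε) + ε • xe ε = 0)
    (t₀ : ℝ) (e : ℝ → ℝ)
    (hepos : ∀ s ∈ Set.Ici t₀, 0 < e s)
    (heC1 : ContDiffOn ℝ 1 e (Set.Ici t₀))
    (t : ℝ) (ht : t₀ ≤ t)
    (e' : ℝ) (he' : HasDerivAt e e' t)
    (u' : H) (hu : HasDerivAt (fun s => xe (e s)) u' t) :
    HasDerivAt (fun s => f (xe (e s)) + (e s / 2) * ‖xe (e s)‖ ^ 2)
      ((1 / 2) * e' * ‖xe (e t)‖ ^ 2) t := by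
  have h1 : HasDerivAt (fun s => f (xe (e s))) (inner ℝ (f' (xe (e t))) u') t := by
    have h := (hgrad (xe (e t))).hasFDerivAt.comp_hasDerivAt t hu
    exact h.congr_deriv (by simp)
  have h2 : HasDerivAt (fun s => ‖xe (e s)‖ ^ 2) (2 * inner ℝ (xe (e t)) u') t := hu.norm_sq
  have h3 := h1.add ((he'.div_const 2).mul h2)
  have h4 : f' (xe (e t)) = -(e t • xe (e t)) :=
    eq_neg_of_add_eq_zero_left (hxe (e t) (hepos t ht))
  refine h3.congr_deriv ?_
  rw [h4, inner_neg_left, real_inner_smul_left]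
  ring
end

section
/- Let ε : [t₀,∞) → (0,∞) be nonincreasing and continuously differentiable, and suppose the map u(t) := x_{ε(t)} is differentiable at a point t ≥ t₀. Then ‖u'(t)‖² ≤ −(ε'(t)/ε(t)) ⟨u'(t), u(t)⟩; consequently ‖u'(t)‖ ≤ −(ε'(t)/ε(t)) ‖x_{ε(t)}‖ ≤ −(ε'(t)/ε(t)) ‖x*‖. -/
open Set

open scoped RealInnerProductSpace

open Filter Topology in
theorem aux_subgrad {H : Type*} [NormedAddCommGroup H] [InnerProductSpace ℝ H] [CompleteSpace H]
    (f : H → ℝ) (f' : H → H) (hconv : ConvexOn ℝ Set.univ f)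
    (hgrad : ∀ x : H, HasGradientAt f (f' x) x) (x y : H) :
    f x + ⟪f' x, y - x⟫ ≤ f y := by
  have hl : HasDerivAt (fun r : ℝ => x + r • (y - x)) (y - x) 0 := by
    simpa using ((hasDerivAt_id (0:ℝ)).smul_const (y - x)).const_add x
  have hf : HasFDerivAt f (InnerProductSpace.toDual ℝ H (f' x)) (x + (0:ℝ) • (y - x)) := by
    simpa using (hgrad x).hasFDerivAt
  have hd : HasDerivAt (fun r : ℝ => f (x + r • (y - x))) ⟪f' x, y - x⟫ 0 := by
    exact hf.comp_hasDerivAt (0:ℝ) hl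
  have ht := (hasDerivAt_iff_tendsto_slope.1 hd).mono_left
    (nhdsWithin_mono (0:ℝ) (fun r (hr : r ∈ Ioi (0:ℝ)) => ne_of_gt hr))
  have : ⟪f' x, y - x⟫ ≤ f y - f x := by
    refine le_of_tendsto ht ?_
    filter_upwards [Ioo_mem_nhdsGT (zero_lt_one (α := ℝ))] with r hr
    have h := hconv.2 (mem_univ x) (mem_univ y) (sub_nonneg.2 hr.2.le) hr.1.le (by ring)
    have hx : (1 - r) • x + r • y = x + r • (y - x) := by module
    rw [hx, smul_eq_mul, smul_eq_mul] at h
    rw [slope_def_field, div_le_iff₀ (by linarith [hr.1])]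
    simp only [zero_smul, add_zero, sub_zero]
    linarith
  linarith

theorem aux_mono {H : Type*} [NormedAddCommGroup H] [InnerProductSpace ℝ H] [CompleteSpace H]
    (f : H → ℝ) (f' : H → H) (hconv : ConvexOn ℝ Set.univ f)
    (hgrad : ∀ x : H, HasGradientAt f (f' x) x) (x y : H) :
    0 ≤ ⟪f' x - f' y, x - y⟫ := by
  have h1 := aux_subgrad f f' hconv hgrad x y
  have h2 := aux_subgrad f f' hconv hgrad y x
  simp only [inner_sub_left, inner_sub_right] at *
  linarith

/-- If `ε` is nonincreasing and `u(t) = x_{ε(t)}` is differentiable at `t`, then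
`‖u'(t)‖² ≤ −(ε'(t)/ε(t)) ⟨u'(t), u(t)⟩`, hence
`‖u'(t)‖ ≤ −(ε'(t)/ε(t))‖x_{ε(t)}‖ ≤ −(ε'(t)/ε(t))‖x*‖`. -/
theorem deriv_tikhonov_curve_estimate
    {H : Type*} [NormedAddCommGroup H] [InnerProductSpace ℝ H] [CompleteSpace H]
    (f : H → ℝ) (f' : H → H) (L : ℝ) (hL : 0 < L)
    (hconv : ConvexOn ℝ Set.univ f)
    (hgrad : ∀ x : H, HasGradientAt f (f' x) x)
    (hlip : ∀ x y : H, ‖f' x - f' y‖ ≤ L * ‖x - y‖)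
    (xstar : H) (hxstar : ∀ y : H, f xstar ≤ f y)
    (hxstar_min : ∀ y : H, (∀ z : H, f y ≤ f z) → ‖xstar‖ ≤ ‖y‖)
    (xe : ℝ → H) (hxe : ∀ ε : ℝ, 0 < ε → f' (xe ε) + ε • xe ε = 0)
    (t₀ : ℝ) (e : ℝ → ℝ)
    (hepos : ∀ s ∈ Set.Ici t₀, 0 < e s)
    (heC1 : ContDiffOn ℝ 1 e (Set.Ici t₀))
    (hmono : AntitoneOn e (Set.Ici t₀))
    (t : ℝ) (ht : t₀ ≤ t)
    (e' : ℝ) (he' : HasDerivAt e e' t)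
    (u' : H) (hu : HasDerivAt (fun s => xe (e s)) u' t) :
    ‖u'‖ ^ 2 ≤ -(e' / e t) * ⟪u', xe (e t)⟫ ∧
    ‖u'‖ ≤ -(e' / e t) * ‖xe (e t)‖ ∧
    -(e' / e t) * ‖xe (e t)‖ ≤ -(e' / e t) * ‖xstar‖ := by
  have het : 0 < e t := hepos t ht
  have hF : ∀ s ∈ Ici t₀, f' (xe (e s)) = -(e s • xe (e s)) := fun s hs =>
    eq_neg_of_add_eq_zero_left (hxe _ (hepos s hs))
  have hsub : nhdsWithin t (Ioi t) ≤ nhdsWithin t {t}ᶜ :=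
    nhdsWithin_mono t (fun r (hr : r ∈ Ioi t) => ne_of_gt hr)
  have he0 : e' ≤ 0 := by
    refine le_of_tendsto ((hasDerivAt_iff_tendsto_slope.1 he').mono_left hsub) ?_
    filter_upwards [self_mem_nhdsWithin] with s hs
    have hs : t < s := hs
    rw [slope_def_field]
    exact div_nonpos_of_nonpos_of_nonneg
      (sub_nonpos.2 (hmono ht (ht.trans hs.le) hs.le)) (sub_nonneg.2 hs.le)
  have hg := he'.smul hu
  have hlim := ((hasDerivAt_iff_tendsto_slope.1 hg).mono_left hsub).inner
    (𝕜 := ℝ) ((hasDerivAt_iff_tendsto_slope.1 hu).mono_left hsub)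
  have hle := le_of_tendsto (b := (0:ℝ)) hlim (by
    filter_upwards [self_mem_nhdsWithin] with s hs
    have hs : t < s := hs
    have hm := aux_mono f f' hconv hgrad (xe (e s)) (xe (e t))
    rw [hF s (ht.trans hs.le), hF t ht] at hm
    have h3 : ⟪e s • xe (e s) - e t • xe (e t), xe (e s) - xe (e t)⟫ ≤ 0 := by
      have : -(e s • xe (e s)) - -(e t • xe (e t)) = -(e s • xe (e s) - e t • xe (e t)) := by
        abel
      rw [this, inner_neg_left] at hm
      linarith
    simp only [slope, vsub_eq_sub, real_inner_smul_left, real_inner_smul_right]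
    have h4 : 0 ≤ (s - t)⁻¹ := inv_nonneg.2 (sub_nonneg.2 hs.le)
    exact mul_nonpos_of_nonneg_of_nonpos h4 (mul_nonpos_of_nonneg_of_nonpos h4 h3))
  simp only [inner_add_left, real_inner_smul_left, real_inner_self_eq_norm_sq] at hle
  rw [real_inner_comm] at hle
  have hc : 0 ≤ -(e' / e t) := neg_nonneg.2 (div_nonpos_of_nonpos_of_nonneg he0 het.le)
  have h1 : ‖u'‖ ^ 2 ≤ -(e' / e t) * ⟪u', xe (e t)⟫ := by
    have : -(e' / e t) * ⟪u', xe (e t)⟫ = (-(e' * ⟪u', xe (e t)⟫)) / e t := by ring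
    rw [this, le_div_iff₀ het]
    linarith
  refine ⟨h1, ?_, ?_⟩
  · rcases (norm_nonneg u').eq_or_lt with h0 | h0
    · rw [← h0]
      exact mul_nonneg hc (norm_nonneg _)
    · have h2 := mul_le_mul_of_nonneg_left (real_inner_le_norm u' (xe (e t))) hc
      refine le_of_mul_le_mul_left ?_ h0
      linarith
  · refine mul_le_mul_of_nonneg_left ?_ hc
    have h5 := aux_subgrad f f' hconv hgrad (xe (e t)) xstar
    have h6 := hxstar (xe (e t))
    rw [hF t ht, inner_neg_left, real_inner_smul_left, inner_sub_right,
      real_inner_self_eq_norm_sq] at h5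
    have h7 := real_inner_le_norm (xe (e t)) xstar
    have h8 : 0 ≤ ⟪xe (e t), xstar⟫ - ‖xe (e t)‖ ^ 2 := by
      by_contra hn
      nlinarith [mul_pos het (neg_pos.2 (not_le.1 hn))]
    rcases (norm_nonneg (xe (e t))).eq_or_lt with h0 | h0
    · rw [← h0]
      exact norm_nonneg _
    · refine le_of_mul_le_mul_left ?_ h0
      linarith
end

section
/- Assume in addition that ε(t) → 0 as t → ∞. If x, y : [t₀,∞) → 𝓗 are functions such that 𝓔(t, x(t), y(t))/ε(t) → 0 as t → ∞, then x(t) converges strongly to x* as t → ∞. -/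
open Set Filter

theorem aux_grad_ineq {H : Type*} [NormedAddCommGroup H] [InnerProductSpace ℝ H] [CompleteSpace H]
    (f : H → ℝ) (g a b : H) (hconv : ConvexOn ℝ Set.univ f) (hg : HasGradientAt f g a) :
    f a + inner ℝ g (b - a) ≤ f b := by
  have h1 : ConvexOn ℝ Set.univ (fun t : ℝ => f (AffineMap.lineMap a b t)) := by
    have := hconv.comp_affineMap (AffineMap.lineMap a b : ℝ →ᵃ[ℝ] H)
    rw [Set.preimage_univ] at this
    exact this
  have h2 : HasDerivAt (fun t : ℝ => f (AffineMap.lineMap a b t)) (inner ℝ g (b - a)) 0 := by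
    have hl : HasDerivAt (fun t : ℝ => (AffineMap.lineMap a b t : H)) (b - a) 0 :=
      AffineMap.hasDerivAt_lineMap
    have hf : HasFDerivAt f (InnerProductSpace.toDual ℝ H g) (AffineMap.lineMap a b (0:ℝ)) := by
      simpa using hg.hasFDerivAt
    have := hf.comp_hasDerivAt (0:ℝ) hl
    exact this
  have h3 := h1.le_slope_of_hasDerivAt (Set.mem_univ 0) (Set.mem_univ 1) one_pos h2
  simp [slope_def_field] at h3
  linarith

theorem aux_strong {H : Type*} [NormedAddCommGroup H] [InnerProductSpace ℝ H] [CompleteSpace H]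
    (f : H → ℝ) (f' : H → H) (hconv : ConvexOn ℝ Set.univ f)
    (hgrad : ∀ x : H, HasGradientAt f (f' x) x) (ε : ℝ) (p x : H) (hp : f' p + ε • p = 0) :
    f p + ε / 2 * ‖p‖ ^ 2 + ε / 2 * ‖x - p‖ ^ 2 ≤ f x + ε / 2 * ‖x‖ ^ 2 := by
  have h1 := aux_grad_ineq f (f' p) p x hconv (hgrad p)
  have h2 : f' p = -(ε • p) := eq_neg_of_add_eq_zero_left hp
  have h3 : ‖x‖ ^ 2 = ‖p‖ ^ 2 + 2 * inner ℝ p (x - p) + ‖x - p‖ ^ 2 := by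
    rw [← norm_add_sq_real]; simp
  rw [h2, inner_neg_left, real_inner_smul_left] at h1
  rw [h3]
  nlinarith

/-- If `ε(t) → 0` as `t → ∞` and `𝓔(t, x(t), y(t))/ε(t) → 0`, then the trajectory `x(t)`
converges strongly to the minimum norm minimizer `x*` of `f`. -/
theorem energy_over_epsilon_tendsto_zero_implies_strong_convergence
    {H : Type*} [NormedAddCommGroup H] [InnerProductSpace ℝ H] [CompleteSpace H]
    (f : H → ℝ) (f' : H → H) (L : ℝ) (hL : 0 < L)
    (hconv : ConvexOn ℝ Set.univ f)
    (hgrad : ∀ x : H, HasGradientAt f (f' x) x)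
    (hlip : ∀ x y : H, ‖f' x - f' y‖ ≤ L * ‖x - y‖)
    (xstar : H) (hxstar : ∀ y : H, f xstar ≤ f y)
    (hxstar_min : ∀ y : H, (∀ z : H, f y ≤ f z) → ‖xstar‖ ≤ ‖y‖)
    (xe : ℝ → H) (hxe : ∀ ε : ℝ, 0 < ε → f' (xe ε) + ε • xe ε = 0)
    (t₀ : ℝ) (ht₀ : 0 < t₀) (e : ℝ → ℝ)
    (hepos : ∀ s ∈ Set.Ici t₀, 0 < e s)
    (heC1 : ContDiffOn ℝ 1 e (Set.Ici t₀))
    (hmono : AntitoneOn e (Set.Ici t₀))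
    (helim : Tendsto e atTop (nhds 0))
    (lam : ℝ) (hlam : 0 < lam)
    (E : ℝ → H → H → ℝ)
    (hE : ∀ (t : ℝ) (x y : H), E t x y =
      (f x + (e t / 2) * ‖x‖ ^ 2) - (f (xe (e t)) + (e t / 2) * ‖xe (e t)‖ ^ 2) +
      (1 / 2) * ‖(lam * Real.sqrt (e t)) • (x - xe (e t)) + y‖ ^ 2)
    (x y : ℝ → H)
    (hlim : Tendsto (fun t => E t (x t) (y t) / e t) atTop (nhds 0)) :
    Tendsto x atTop (nhds xstar) := by
  have hS := fun (ε : ℝ) (p x : H) hp => aux_strong f f' hconv hgrad ε p x hp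
  -- trajectory of regularized minimizers
  set v : ℝ → H := fun t => xe (e (max t t₀)) with hv
  have hpos : ∀ t, 0 < e (max t t₀) := fun t => hepos _ (Set.mem_Ici.2 (le_max_right _ _))
  have hkey : ∀ s t, s ≤ t → ‖v t - v s‖ ^ 2 ≤ ‖v t‖ ^ 2 - ‖v s‖ ^ 2 := by
    intro s t hst
    have hle : e (max t t₀) ≤ e (max s t₀) :=
      hmono (Set.mem_Ici.2 (le_max_right _ _)) (Set.mem_Ici.2 (le_max_right _ _)) (max_le_max_right _ hst)
    rcases hle.eq_or_lt with h | h
    · simp [hv, h]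
    · have h1 := hS _ (v s) (v t) (hxe _ (hpos s))
      have h2 := hS _ (v t) (v s) (hxe _ (hpos t))
      rw [norm_sub_rev (v s)] at h2
      have h3 := hpos t
      have h4 := sq_nonneg ‖v t - v s‖
      have h5 : 0 ≤ (e (max s t₀) - e (max t t₀)) *
          (‖v t‖ ^ 2 - ‖v s‖ ^ 2 - ‖v t - v s‖ ^ 2) := by nlinarith
      have := nonneg_of_mul_nonneg_right h5 (sub_pos.2 h)
      linarith
  have hstar : ∀ t, f (v t) - f xstar + e (max t t₀) / 2 * (‖v t‖ ^ 2 + ‖xstar - v t‖ ^ 2)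
      ≤ e (max t t₀) / 2 * ‖xstar‖ ^ 2 := by
    intro t
    have h1 := hS _ (v t) xstar (hxe _ (hpos t))
    linarith
  have hbd : ∀ t, ‖v t‖ ^ 2 + ‖xstar - v t‖ ^ 2 ≤ ‖xstar‖ ^ 2 := by
    intro t
    have h1 := hstar t
    have h2 := hxstar (v t)
    have h3 := hpos t
    refine le_of_mul_le_mul_left (a := e (max t t₀) / 2) ?_ (by linarith)
    linarith
  have hN : Monotone (fun t => ‖v t‖ ^ 2) := by
    intro s t hst
    have := hkey s t hst
    have := sq_nonneg ‖v t - v s‖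
    show ‖v s‖ ^ 2 ≤ ‖v t‖ ^ 2
    linarith
  have hNb : BddAbove (Set.range (fun t => ‖v t‖ ^ 2)) := by
    refine ⟨‖xstar‖ ^ 2, ?_⟩
    rintro _ ⟨t, rfl⟩
    have := hbd t
    have := sq_nonneg ‖xstar - v t‖
    show ‖v t‖ ^ 2 ≤ _
    linarith
  have hNC : CauchySeq (fun t => ‖v t‖ ^ 2) := (tendsto_atTop_ciSup hN hNb).cauchySeq
  have hvC : CauchySeq v := by
    rw [Metric.cauchySeq_iff'] at hNC ⊢
    intro r hr
    obtain ⟨T, hT⟩ := hNC (r ^ 2) (by positivity)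
    refine ⟨T, fun t ht => ?_⟩
    have h1 := hT t ht
    rw [Real.dist_eq] at h1
    have h2 := (abs_lt.1 h1).2
    have h3 := hkey T t ht
    rw [dist_eq_norm]
    exact lt_of_pow_lt_pow_left₀ 2 hr.le (by linarith)
  obtain ⟨z, hz⟩ := cauchySeq_tendsto_of_complete hvC
  have hmax : ∀ᶠ t in atTop, max t t₀ = t := by
    filter_upwards [eventually_ge_atTop t₀] with t ht using max_eq_left ht
  have he' : Tendsto (fun t => e (max t t₀)) atTop (nhds 0) :=
    helim.congr' (by filter_upwards [hmax] with t ht using by rw [ht])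
  have hfz : Tendsto (fun t => f (v t)) atTop (nhds (f z)) :=
    ((hgrad z).hasFDerivAt.continuousAt.tendsto).comp hz
  have hfle : f z ≤ f xstar := by
    have h1 : Tendsto (fun t => f xstar + e (max t t₀) / 2 * ‖xstar‖ ^ 2) atTop
        (nhds (f xstar + 0 / 2 * ‖xstar‖ ^ 2)) :=
      ((he'.div_const 2).mul_const _).const_add _
    have h2 := le_of_tendsto_of_tendsto' hfz h1 (fun t => by
      have h1 := hstar t
      have h3 := hpos t
      have : 0 ≤ e (max t t₀) / 2 * (‖v t‖ ^ 2 + ‖xstar - v t‖ ^ 2) := by positivity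
      linarith)
    simpa using h2
  have hzn := hxstar_min z (fun w => hfle.trans (hxstar w))
  have hzb : ‖z‖ ^ 2 + ‖xstar - z‖ ^ 2 ≤ ‖xstar‖ ^ 2 :=
    le_of_tendsto' ((hz.norm.pow 2).add ((hz.const_sub xstar).norm.pow 2)) hbd
  have hzx : xstar = z := by
    have h1 : ‖xstar‖ ^ 2 ≤ ‖z‖ ^ 2 := pow_le_pow_left₀ (norm_nonneg _) hzn 2
    have h2 : ‖xstar - z‖ ^ 2 = 0 := le_antisymm (by linarith) (sq_nonneg _)
    exact sub_eq_zero.1 (norm_eq_zero.1 (pow_eq_zero_iff (two_ne_zero) |>.1 h2))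
  rw [← hzx] at hz
  have hsq : Tendsto (fun t => ‖x t - v t‖ ^ 2) atTop (nhds 0) := by
    have h2 : Tendsto (fun t => 2 * (E t (x t) (y t) / e t)) atTop (nhds 0) := by
      simpa using hlim.const_mul 2
    refine squeeze_zero' (Eventually.of_forall fun t => sq_nonneg _) ?_ h2
    filter_upwards [eventually_ge_atTop t₀] with t ht
    have hp := hepos t ht
    have h1 := hS _ (xe (e t)) (x t) (hxe _ hp)
    have h3 : v t = xe (e t) := by simp [hv, max_eq_left ht]
    rw [h3, hE, ← mul_div_assoc, le_div_iff₀ hp]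
    have := sq_nonneg ‖(lam * Real.sqrt (e t)) • (x t - xe (e t)) + y t‖
    linarith
  have hd : Tendsto (fun t => x t - v t) atTop (nhds 0) := by
    rw [tendsto_zero_iff_norm_tendsto_zero]
    have := hsq.sqrt
    simpa using this
  simpa using hd.add hz
end

section
/- Let 0 < r < 2, a > 1, c > 2, and 0 < λ < δ, t₁ > 0. Define γ(s) := (s/t₁)^{r/2} · exp((2(δ − λ)/(2 − r))(s^{(2−r)/2} − t₁^{(2−r)/2})) and G(s) := (a + c)λ r² s^{−(r/2)−2} + r s^{−r−1}. Then for all t ≥ t₁: (1/γ(t)) ∫_{t₁}^{t} G(s)γ(s) ds ≤ t^{−r/2} ( (a + c)λ r² (1/t₁ − 1/t) + 2(t₁^{−r/2} − t^{−r/2}) ). In particular, (1/γ(t)) ∫_{t₁}^{t} G(s)γ(s) ds → 0 as t → ∞. -/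
open Filter

/-- For `ε(t) = t^{−r}` with `0 < r < 2`, the weighted average of
`G(s) = (a + c)λ r² s^{−r/2−2} + r s^{−r−1}` against the integrating factor
`γ(s) = (s/t₁)^{r/2}·exp((2(δ − λ)/(2 − r))(s^{(2−r)/2} − t₁^{(2−r)/2}))` satisfies
`(1/γ(t))∫_{t₁}^{t} G(s)γ(s) ds ≤ t^{−r/2}((a + c)λr²(1/t₁ − 1/t) + 2(t₁^{−r/2} − t^{−r/2}))`
for all `t ≥ t₁`, and in particular tends to `0` as `t → ∞`. -/
theorem weighted_average_G_tendsto_zero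
    (r a c lam δ t₁ : ℝ)
    (hr : 0 < r) (hr2 : r < 2) (ha : 1 < a) (hc : 2 < c)
    (hlam : 0 < lam) (hlam' : lam < δ) (ht₁ : 0 < t₁)
    (γ G : ℝ → ℝ)
    (hγ : ∀ s : ℝ, γ s = (s / t₁) ^ (r / 2) *
      Real.exp ((2 * (δ - lam) / (2 - r)) * (s ^ ((2 - r) / 2) - t₁ ^ ((2 - r) / 2))))
    (hG : ∀ s : ℝ, G s = (a + c) * lam * r ^ 2 * s ^ (-(r / 2) - 2) + r * s ^ (-r - 1)) :
    (∀ t : ℝ, t₁ ≤ t →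
      (1 / γ t) * ∫ s in t₁..t, G s * γ s ≤
        t ^ (-(r / 2)) *
          ((a + c) * lam * r ^ 2 * (1 / t₁ - 1 / t) + 2 * (t₁ ^ (-(r / 2)) - t ^ (-(r / 2))))) ∧
    Tendsto (fun t : ℝ => (1 / γ t) * ∫ s in t₁..t, G s * γ s) atTop (nhds 0) := by
  have hK : 0 < (a + c) * lam * r ^ 2 := by
    have : 0 < a + c := by linarith
    positivity
  set K := (a + c) * lam * r ^ 2 with hKdef
  have hγpos : ∀ s, 0 < s → 0 < γ s := by
    intro s hs
    rw [hγ]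
    positivity
  have hGpos : ∀ s, 0 < s → 0 ≤ G s := by
    intro s hs
    rw [hG]
    positivity
  have hbound : ∀ t : ℝ, t₁ ≤ t →
      (1 / γ t) * ∫ s in t₁..t, G s * γ s ≤
        t ^ (-(r / 2)) *
          (K * (1 / t₁ - 1 / t) + 2 * (t₁ ^ (-(r / 2)) - t ^ (-(r / 2)))) := by
    intro t ht
    have htpos : 0 < t := lt_of_lt_of_le ht₁ ht
    have hmem : ∀ s ∈ Set.uIcc t₁ t, 0 < s := by
      intro s hs
      rw [Set.uIcc_of_le ht] at hs
      exact lt_of_lt_of_le ht₁ hs.1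
    have hcpow : ∀ p : ℝ, ContinuousOn (fun s : ℝ => s ^ p) (Set.uIcc t₁ t) := by
      intro p s hs
      exact (Real.continuousAt_rpow_const s p (Or.inl (hmem s hs).ne')).continuousWithinAt
    set f : ℝ → ℝ := fun s => K * s ^ (-2 : ℝ) + r * s ^ (-(r / 2) - 1) with hf
    have hfc : ContinuousOn f (Set.uIcc t₁ t) :=
      ((hcpow _).const_mul K).add ((hcpow _).const_mul r)
    have hfint : ∫ s in t₁..t, f s =
        K * (1 / t₁ - 1 / t) + 2 * (t₁ ^ (-(r / 2)) - t ^ (-(r / 2))) := by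
      have := intervalIntegral.integral_eq_sub_of_hasDerivAt
        (f := fun s : ℝ => (-K) * s ^ (-1 : ℝ) + (-2) * s ^ (-(r / 2))) (f' := f)
        (a := t₁) (b := t) (fun s hs => by
          have h1 := (Real.hasDerivAt_rpow_const (x := s) (p := (-1 : ℝ))
            (Or.inl (hmem s hs).ne')).const_mul (-K)
          have h2 := (Real.hasDerivAt_rpow_const (x := s) (p := -(r / 2))
            (Or.inl (hmem s hs).ne')).const_mul (-2)
          have h3 := h1.add h2
          refine HasDerivAt.congr_deriv h3 ?_
          rw [hf, show (-1 - 1 : ℝ) = -2 by norm_num]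
          ring) hfc.intervalIntegrable
      rw [this]
      simp only [Real.rpow_neg_one, one_div]
      ring
    set C : ℝ := t₁ ^ (-(r / 2)) *
      Real.exp ((2 * (δ - lam) / (2 - r)) * (t ^ ((2 - r) / 2) - t₁ ^ ((2 - r) / 2))) with hC
    have hCpos : 0 < C := by positivity
    have hγt : γ t = t ^ (r / 2) * C := by
      rw [hγ, hC, Real.div_rpow htpos.le ht₁.le, Real.rpow_neg ht₁.le]
      ring
    have hpt : ∀ s ∈ Set.Icc t₁ t, G s * γ s ≤ C * f s := by
      intro s hs
      have hs0 : 0 < s := lt_of_lt_of_le ht₁ hs.1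
      have hγs : γ s ≤ s ^ (r / 2) * C := by
        rw [hγ, hC, Real.div_rpow hs0.le ht₁.le, Real.rpow_neg ht₁.le, div_eq_mul_inv, mul_assoc]
        have h1 : s ^ ((2 - r) / 2) ≤ t ^ ((2 - r) / 2) :=
          Real.rpow_le_rpow hs0.le hs.2 (by linarith)
        have h2 : 0 ≤ 2 * (δ - lam) / (2 - r) :=
          div_nonneg (by linarith) (by linarith)
        gcongr
      calc G s * γ s ≤ G s * (s ^ (r / 2) * C) :=
            mul_le_mul_of_nonneg_left hγs (hGpos s hs0)
        _ = C * f s := by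
            have e1 : s ^ (-2 : ℝ) = s ^ (-(r / 2) - 2) * s ^ (r / 2) := by
              rw [← Real.rpow_add hs0]; congr 1; ring
            have e2 : s ^ (-(r / 2) - 1) = s ^ (-r - 1) * s ^ (r / 2) := by
              rw [← Real.rpow_add hs0]; congr 1; ring
            rw [hf, hG]
            simp only [e1, e2]
            ring
    have hGγc : ContinuousOn (fun s => G s * γ s) (Set.uIcc t₁ t) := by
      have hGc : ContinuousOn G (Set.uIcc t₁ t) := by
        rw [show G = _ from funext hG]
        exact ((hcpow _).const_mul K).add ((hcpow _).const_mul r)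
      have hγc : ContinuousOn γ (Set.uIcc t₁ t) := by
        rw [show γ = _ from funext hγ]
        refine ContinuousOn.mul ?_ ?_
        · exact (continuousOn_id.div_const t₁).rpow_const (fun s hs => Or.inr (by linarith))
        · exact (((hcpow _).sub continuousOn_const).const_mul _).rexp
      exact hGc.mul hγc
    have hle : ∫ s in t₁..t, G s * γ s ≤ ∫ s in t₁..t, C * f s :=
      intervalIntegral.integral_mono_on ht hGγc.intervalIntegrable
        (hfc.const_mul C).intervalIntegrable hpt
    rw [intervalIntegral.integral_const_mul, hfint] at hle
    have hp : 0 < t ^ (r / 2) := by positivity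
    calc (1 / γ t) * ∫ s in t₁..t, G s * γ s
        ≤ (1 / γ t) * (C * (K * (1 / t₁ - 1 / t) +
            2 * (t₁ ^ (-(r / 2)) - t ^ (-(r / 2))))) :=
          mul_le_mul_of_nonneg_left hle (one_div_pos.2 (hγpos t htpos)).le
      _ = _ := by
          have e : 1 / γ t * C = t ^ (-(r / 2)) := by
            rw [hγt, Real.rpow_neg htpos.le]
            field_simp
          rw [← mul_assoc, e]
  refine ⟨hbound, ?_⟩
  have hlim : Tendsto (fun t : ℝ => t ^ (-(r / 2)) * (K * (1 / t₁) + 2 * t₁ ^ (-(r / 2))))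
      atTop (nhds 0) := by
    have := (tendsto_rpow_neg_atTop (y := r / 2) (by linarith)).mul_const
      (K * (1 / t₁) + 2 * t₁ ^ (-(r / 2)))
    simpa only [zero_mul] using this
  refine tendsto_of_tendsto_of_tendsto_of_le_of_le' tendsto_const_nhds hlim ?_ ?_
  · filter_upwards [eventually_ge_atTop t₁] with t ht
    have htpos : 0 < t := lt_of_lt_of_le ht₁ ht
    refine mul_nonneg (one_div_pos.2 (hγpos t htpos)).le ?_
    refine intervalIntegral.integral_nonneg ht fun s hs => ?_
    have hs0 : 0 < s := lt_of_lt_of_le ht₁ hs.1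
    exact mul_nonneg (hGpos s hs0) (hγpos s hs0).le
  · filter_upwards [eventually_ge_atTop t₁] with t ht
    have htpos : 0 < t := lt_of_lt_of_le ht₁ ht
    refine (hbound t ht).trans (mul_le_mul_of_nonneg_left ?_ (by positivity))
    have h1 : 0 ≤ K * (1 / t) := by positivity
    have h2 : 0 ≤ t ^ (-(r / 2)) := by positivity
    linarith
end

section
/- (Deterministic convergence rates for TRIGS with ε(t) = t^{−r}, i.e. Theorem 3.2 of the paper with zero diffusion.) Let 0 < r < 2, t₀ > 0 and ε(t) := t^{−r}; suppose the map t ↦ x_{ε(t)} is differentiable on [t₀,∞). Let δ > 0 and suppose there exist a > 1, c > 2 and λ with δ/2 < λ < δ, λ < aδ/(a+1) and (δ + 1/c)λ − λ² − 1 ≤ 0. Let x : [t₀,∞) → 𝓗 be twice differentiable with ẍ(t) + δ t^{−r/2} ẋ(t) + ∇f(x(t)) + t^{−r} x(t) = 0 for all t ≥ t₀. Then, as t → ∞: 𝓔(t, x(t), ẋ(t)) = O(t^{−(r+2)/2}); consequently f(x(t)) − inf_𝓗 f = O(t^{−r}), ‖x(t) − x_{ε(t)}‖² = O(t^{−(2−r)/2}),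 ‖ẋ(t)‖ = O(t^{−(r+2)/4}) if r ∈ [2/3, 2) and ‖ẋ(t)‖ = O(t^{−r}) if r ∈ (0, 2/3), and x(t) converges strongly to x*. -/
open Set Filter Asymptotics

section TrigsAux
variable {H : Type*} [NormedAddCommGroup H] [InnerProductSpace ℝ H]

lemma trigs_grad_ineq [CompleteSpace H] (f : H → ℝ) (f' : H → H)
    (hconv : ConvexOn ℝ Set.univ f)
    (hgrad : ∀ x : H, HasGradientAt f (f' x) x) (w u : H) :
    f w + inner ℝ (f' w) (u - w) ≤ f u := by
  have hline : HasDerivAt (fun τ : ℝ => AffineMap.lineMap (k := ℝ) w u τ) (u - w) 0 := by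
    simpa using AffineMap.hasDerivAt_lineMap (a := w) (b := u) (x := (0:ℝ))
  have h0 : HasFDerivAt f (InnerProductSpace.toDual ℝ H (f' w))
      (AffineMap.lineMap (k := ℝ) w u (0:ℝ)) := by
    simpa using (hgrad w).hasFDerivAt
  have hd := h0.comp_hasDerivAt (0:ℝ) hline
  have hc : ConvexOn ℝ Set.univ (f ∘ (AffineMap.lineMap (k := ℝ) w u : ℝ →ᵃ[ℝ] H)) := by
    simpa using hconv.comp_affineMap (AffineMap.lineMap (k := ℝ) w u)
  have := hc.le_slope_of_hasDerivAt (mem_univ 0) (mem_univ 1) one_pos hd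
  simp [slope_def_field] at this
  linarith

lemma trigs_strong (y u : H) (ε : ℝ) (fy fu : ℝ) (gy : H) (h0 : gy + ε • y = 0)
    (h : fy + inner ℝ gy (u - y) ≤ fu) :
    fy + ε / 2 * ‖y‖ ^ 2 + ε / 2 * ‖u - y‖ ^ 2 ≤ fu + ε / 2 * ‖u‖ ^ 2 := by
  have : gy = -(ε • y) := eq_neg_of_add_eq_zero_left h0
  subst this
  rw [inner_neg_left, inner_smul_left, inner_sub_right, real_inner_self_eq_norm_sq] at h
  rw [norm_sub_sq_real, real_inner_comm]
  simp at h
  linarith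

lemma trigs_strong2 (y u : H) (ε : ℝ) (fy fu : ℝ) (gu : H) 
    (h : fu + inner ℝ gu (y - u) ≤ fy) :
    (fu + ε / 2 * ‖u‖ ^ 2) - (fy + ε / 2 * ‖y‖ ^ 2) + ε / 2 * ‖u - y‖ ^ 2 ≤
      inner ℝ (u - y) (gu + ε • u) := by
  rw [norm_sub_sq_real]
  simp only [inner_add_right, inner_sub_left, inner_sub_right, inner_smul_right,
    real_inner_self_eq_norm_sq] at h ⊢
  rw [real_inner_comm y u, real_inner_comm gu u, real_inner_comm gu y]
  linarith

lemma trigs_identity (z p q g : H) (lam s s1 δ : ℝ) :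
    inner ℝ g p + inner ℝ ((lam * s) • z + p)
      ((lam * s1) • z + (lam * s) • (p - q) - (δ * s) • p - g) =
    lam ^ 2 * s * s1 * ‖z‖ ^ 2 + lam * s1 * inner ℝ z p + lam * (lam - δ) * s ^ 2 * inner ℝ z p
      + (lam - δ) * s * ‖p‖ ^ 2 - lam ^ 2 * s ^ 2 * inner ℝ z q - lam * s * inner ℝ p q
      - lam * s * inner ℝ z g := by
  simp only [inner_add_right, inner_add_left, inner_sub_left, inner_sub_right, inner_smul_right,
    inner_smul_left, real_inner_self_eq_norm_sq, conj_trivial]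
  rw [real_inner_comm p g, real_inner_comm z p]
  ring

/-- scalar estimate -/
lemma trigs_scalar (lam d r κ K : ℝ) (hlam : 0 < lam) (hd : 0 < d) (hα : lam * d ≤ 1)
    (hr : 0 < r) (hκ : 0 < κ) 
    (hκ1 : lam * r * κ ≤ lam / 8) (hκ2 : lam * r * κ ≤ d / 3)
    (hK0 : 0 < K) (hK1 : K ≤ lam) (hK2 : K * lam ≤ 1 / 16) (hK3 : K ≤ d / 6)
    (G w P D : ℝ) (hG : 0 ≤ G) (hw : 0 ≤ w) (hP : 0 ≤ P) :
    -lam * G - lam / 2 * w ^ 2 + (lam * d + lam * r * κ / 2) * (w * P) - d * P ^ 2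
      + lam ^ 2 * (w * D) + lam * (P * D) ≤
    - K * (G + lam ^ 2 * w ^ 2 + P ^ 2) + (8 * lam ^ 3 + 3 * lam ^ 2 / d) * D ^ 2 := by
  have h1 : lam * d * (w * P) ≤ 3 / 8 * lam * w ^ 2 + 2 / 3 * d * P ^ 2 := by
    have e1 : lam * d * (w * P) ≤ 3 / 8 * lam * w ^ 2 + 2 / 3 * lam * d ^ 2 * P ^ 2 := by
      nlinarith [mul_nonneg hlam.le (sq_nonneg (3 * w - 4 * d * P))]
    have e2 : lam * d * (d * P ^ 2) ≤ 1 * (d * P ^ 2) :=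
      mul_le_mul_of_nonneg_right hα (by positivity)
    nlinarith
  have h2 : lam * r * κ / 2 * (w * P) ≤ lam / 32 * w ^ 2 + d / 12 * P ^ 2 := by
    have e1 : lam * r * κ / 2 * (w * P) ≤ lam * r * κ / 4 * w ^ 2 + lam * r * κ / 4 * P ^ 2 := by
      nlinarith [mul_nonneg (by positivity : 0 ≤ lam * r * κ) (sq_nonneg (w - P))]
    have e2 := mul_le_mul_of_nonneg_right hκ1 (sq_nonneg w)
    have e3 := mul_le_mul_of_nonneg_right hκ2 (sq_nonneg P)
    linarith
  have h3 : lam ^ 2 * (w * D) ≤ lam / 32 * w ^ 2 + 8 * lam ^ 3 * D ^ 2 := by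
    nlinarith [mul_nonneg hlam.le (sq_nonneg (w - 16 * lam * D))]
  have h4 : lam * (P * D) ≤ d / 12 * P ^ 2 + 3 * lam ^ 2 / d * D ^ 2 := by
    have : d / 12 * P ^ 2 + 3 * lam ^ 2 / d * D ^ 2 - lam * (P * D) =
      (d * P - 6 * lam * D) ^ 2 / (12 * d) := by field_simp; ring
    have h : 0 ≤ (d * P - 6 * lam * D) ^ 2 / (12 * d) := by positivity
    linarith
  have h5 := mul_le_mul_of_nonneg_right hK1 hG
  have h6 : K * lam * (lam * w ^ 2) ≤ 1 / 16 * (lam * w ^ 2) :=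
    mul_le_mul_of_nonneg_right hK2 (by positivity)
  have h7 := mul_le_mul_of_nonneg_right hK3 (sq_nonneg P)
  nlinarith

/-- Gronwall type bound. -/
lemma trigs_gronwall (W W' : ℝ → ℝ) (T M : ℝ) 
    (hW : ∀ t, T ≤ t → HasDerivAt W (W' t) t) (hT : W T ≤ M)
    (hb : ∀ t, T ≤ t → W t = M → W' t < 0) : ∀ t, T ≤ t → W t ≤ M := by
  intro t ht
  have := image_le_of_deriv_right_lt_deriv_boundary (f := W) (f' := W') (a := T) (b := t)
    (fun s hs => (hW s hs.1).continuousAt.continuousWithinAt)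
    (fun s hs => (hW s hs.1).hasDerivWithinAt) (B := fun _ => M) (B' := fun _ => 0) hT
    (fun s => hasDerivAt_const s M) (fun s hs h => hb s hs.1 h)
  exact this ⟨ht, le_rfl⟩

/-- energy derivative bound -/
lemma trigs_energy_bound (z p q g : H) (lam δ r κ K s h N G : ℝ) (hlam : 0 < lam) (hd : lam < δ)
    (hα : lam * (δ - lam) ≤ 1)
    (hr : 0 < r) (hκ : 0 < κ) 
    (hκ1 : lam * r * κ ≤ lam / 8) (hκ2 : lam * r * κ ≤ (δ - lam) / 3)
    (hK0 : 0 < K) (hK1 : K ≤ lam) (hK2 : K * lam ≤ 1 / 16) (hK3 : K ≤ (δ - lam) / 6)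
    (hs : 0 < s) (hh : 0 < h) (hhs : h ≤ κ * s) (hG : 0 ≤ G)
    (hN : 0 ≤ N) (hq : ‖q‖ ≤ 2 * r * N * h)
    (hg : G + s ^ 2 / 2 * ‖z‖ ^ 2 ≤ inner ℝ z g) :
    inner ℝ g p + inner ℝ ((lam * s) • z + p)
      ((lam * (-(r / 2) * s * h)) • z + (lam * s) • (p - q) - (δ * s) • p - g) ≤
    - K * s * (G + 1 / 2 * ‖(lam * s) • z + p‖ ^ 2) +
      (8 * lam ^ 3 + 3 * lam ^ 2 / (δ - lam)) * (2 * r * N) ^ 2 * κ * (s ^ 2 * h) := by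
  rw [trigs_identity]
  have hzp := abs_le.1 (abs_real_inner_le_norm z p)
  have hzq := abs_le.1 (abs_real_inner_le_norm z q)
  have hpq := abs_le.1 (abs_real_inner_le_norm p q)
  have hS := trigs_scalar lam (δ - lam) r κ K hlam (by linarith) hα hr hκ hκ1 hκ2 hK0 hK1 hK2 hK3
    G (s * ‖z‖) ‖p‖ ‖q‖ hG (by positivity) (by positivity)
  have hn : ‖(lam * s) • z + p‖ ^ 2 ≤ 2 * (lam ^ 2 * (s * ‖z‖) ^ 2 + ‖p‖ ^ 2) := by
    have h1 := norm_add_le ((lam * s) • z) p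
    rw [norm_smul, Real.norm_of_nonneg (by positivity)] at h1
    have h2 := pow_le_pow_left₀ (norm_nonneg _) h1 2
    nlinarith [sq_nonneg (lam * s * ‖z‖ - ‖p‖)]
  set A := 8 * lam ^ 3 + 3 * lam ^ 2 / (δ - lam) with hA
  have hA0 : 0 ≤ A := by
    have : 0 < δ - lam := by linarith
    positivity
  have hqq : ‖q‖ ^ 2 ≤ (2 * r * N) ^ 2 * (κ * s * h) := by
    calc ‖q‖ ^ 2 ≤ (2 * r * N * h) ^ 2 := pow_le_pow_left₀ (norm_nonneg _) hq 2
      _ = (2 * r * N) ^ 2 * (h * h) := by ring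
      _ ≤ _ := by gcongr
  have t1 : lam ^ 2 * s * (-(r / 2) * s * h) * ‖z‖ ^ 2 ≤ 0 := by
    have : 0 ≤ lam ^ 2 * s * ((r / 2) * s * h) * ‖z‖ ^ 2 := by positivity
    linarith
  have t2 : lam * (-(r / 2) * s * h) * inner ℝ z p ≤ s * (lam * r * κ / 2 * (s * ‖z‖ * ‖p‖)) := by
    calc lam * (-(r / 2) * s * h) * inner ℝ z p = (lam * ((r / 2) * s * h)) * (- inner ℝ z p) := by
          ring
      _ ≤ (lam * ((r / 2) * s * h)) * (‖z‖ * ‖p‖) := by gcongr; linarith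
      _ ≤ (lam * ((r / 2) * s * (κ * s))) * (‖z‖ * ‖p‖) := by gcongr
      _ = _ := by ring
  have t3 : lam * (lam - δ) * s ^ 2 * inner ℝ z p ≤ s * (lam * (δ - lam) * (s * ‖z‖ * ‖p‖)) := by
    have hd' : 0 < δ - lam := by linarith
    calc lam * (lam - δ) * s ^ 2 * inner ℝ z p = lam * (δ - lam) * s ^ 2 * (-inner ℝ z p) := by ring
      _ ≤ lam * (δ - lam) * s ^ 2 * (‖z‖ * ‖p‖) := by gcongr; linarith
      _ = _ := by ring
  have t4 : -(lam ^ 2 * s ^ 2 * inner ℝ z q) ≤ s * (lam ^ 2 * (s * ‖z‖ * ‖q‖)) := by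
    calc -(lam ^ 2 * s ^ 2 * inner ℝ z q) = lam ^ 2 * s ^ 2 * (- inner ℝ z q) := by ring
      _ ≤ lam ^ 2 * s ^ 2 * (‖z‖ * ‖q‖) := by gcongr; linarith
      _ = _ := by ring
  have t5 : -(lam * s * inner ℝ p q) ≤ s * (lam * (‖p‖ * ‖q‖)) := by
    calc -(lam * s * inner ℝ p q) = lam * s * (- inner ℝ p q) := by ring
      _ ≤ lam * s * (‖p‖ * ‖q‖) := by gcongr; linarith
      _ = _ := by ring
  have t6 : lam * s * (G + s ^ 2 / 2 * ‖z‖ ^ 2) ≤ lam * s * inner ℝ z g := by gcongr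
  have hS2 := mul_le_mul_of_nonneg_left hS hs.le
  have t7 : K * s * (1 / 2 * ‖(lam * s) • z + p‖ ^ 2) ≤
      K * s * (lam ^ 2 * (s * ‖z‖) ^ 2 + ‖p‖ ^ 2) := by gcongr; linarith
  have t8 : s * (A * ‖q‖ ^ 2) ≤ s * (A * ((2 * r * N) ^ 2 * (κ * s * h))) := by gcongr
  linarith

/-- comparison of regularised minimizers -/
lemma trigs_ye_mono (y1 y2 : H) (e1 e2 f1 f2 : ℝ) (he2 : 0 ≤ e2) (he : e2 < e1)
    (h1 : f1 + e1 / 2 * ‖y1‖ ^ 2 + e1 / 2 * ‖y2 - y1‖ ^ 2 ≤ f2 + e1 / 2 * ‖y2‖ ^ 2)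
    (h2 : f2 + e2 / 2 * ‖y2‖ ^ 2 ≤ f1 + e2 / 2 * ‖y1‖ ^ 2) :
    ‖y2 - y1‖ ^ 2 ≤ ‖y2‖ ^ 2 - ‖y1‖ ^ 2 := by
  have : (e1 - e2) * ‖y2 - y1‖ ^ 2 ≤ (e1 - e2) * (‖y2‖ ^ 2 - ‖y1‖ ^ 2) := by
    nlinarith [mul_nonneg he2 (sq_nonneg ‖y2 - y1‖)]
  exact le_of_mul_le_mul_left this (by linarith)

lemma trigs_ye_lip (y1 y2 : H) (e1 e2 f1 f2 N : ℝ) (he1 : 0 < e1) (he2 : 0 < e2)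
    (h1 : f1 + e1 / 2 * ‖y1‖ ^ 2 + e1 / 2 * ‖y2 - y1‖ ^ 2 ≤ f2 + e1 / 2 * ‖y2‖ ^ 2)
    (h2 : f2 + e2 / 2 * ‖y2‖ ^ 2 + e2 / 2 * ‖y1 - y2‖ ^ 2 ≤ f1 + e2 / 2 * ‖y1‖ ^ 2)
    (hn1 : ‖y1‖ ≤ N) (hn2 : ‖y2‖ ≤ N) :
    e1 * ‖y2 - y1‖ ≤ 2 * N * |e2 - e1| := by
  rw [norm_sub_rev y1 y2] at h2
  have hN : 0 ≤ N := (norm_nonneg _).trans hn1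
  have ha : |‖y2‖ - ‖y1‖| ≤ ‖y2 - y1‖ := abs_norm_sub_norm_le y2 y1
  have hb : |‖y2‖ ^ 2 - ‖y1‖ ^ 2| ≤ ‖y2 - y1‖ * (2 * N) := by
    rw [show ‖y2‖ ^ 2 - ‖y1‖ ^ 2 = (‖y2‖ - ‖y1‖) * (‖y2‖ + ‖y1‖) by ring, abs_mul,
      abs_of_nonneg (by positivity : 0 ≤ ‖y2‖ + ‖y1‖)]
    gcongr
    linarith
  rcases (norm_nonneg (y2 - y1)).eq_or_lt with h0 | h0
  · rw [← h0, mul_zero]; positivity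
  have hc : (e1 + e2) * ‖y2 - y1‖ ^ 2 ≤ |e2 - e1| * (‖y2 - y1‖ * (2 * N)) := by
    calc (e1 + e2) * ‖y2 - y1‖ ^ 2 ≤ -((e2 - e1) * (‖y2‖ ^ 2 - ‖y1‖ ^ 2)) := by linarith
      _ ≤ |(e2 - e1) * (‖y2‖ ^ 2 - ‖y1‖ ^ 2)| := neg_le_abs _
      _ = |e2 - e1| * |‖y2‖ ^ 2 - ‖y1‖ ^ 2| := abs_mul _ _
      _ ≤ _ := by gcongr
  refine le_of_mul_le_mul_right ?_ h0
  nlinarith [mul_nonneg he2.le (sq_nonneg ‖y2 - y1‖)]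

/-- derivative bound for the regularised curve -/
lemma trigs_yderiv (Y : ℝ → H) (e : ℝ → ℝ) (q : H) (e1 B t : ℝ) (he : HasDerivAt e e1 t)
    (he1 : e1 ≠ 0) (hY : HasDerivAt Y q t) (hpos : 0 < e t) (hB : 0 ≤ B)
    (h : ∀ᶠ s in nhds t, e t * ‖Y s - Y t‖ ≤ B * |e s - e t|) :
    ‖q‖ ≤ 2 * B * (|e1| / e t) := by
  have h1 : ∀ᶠ s in nhds t, |e s - e t| ≤ 2 * |e1| * |s - t| := by
    have := (hasDerivAt_iff_isLittleO.1 he).def (abs_pos.2 he1)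
    filter_upwards [this] with s hs
    rw [Real.norm_eq_abs, Real.norm_eq_abs, smul_eq_mul] at hs
    have h3 : |e s - e t| ≤ |e s - e t - (s - t) * e1| + |(s - t) * e1| := by
      simpa using abs_add_le (e s - e t - (s - t) * e1) ((s - t) * e1)
    rw [abs_mul] at h3
    linarith
  refine hY.le_of_lip' (by positivity) ?_
  filter_upwards [h, h1] with s hs hs1
  rw [Real.norm_eq_abs]
  have : e t * ‖Y s - Y t‖ ≤ e t * (2 * B * (|e1| / e t) * |s - t|) := by
    calc _ ≤ B * |e s - e t| := hs
      _ ≤ B * (2 * |e1| * |s - t|) := by gcongr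
      _ = _ := by field_simp
  exact le_of_mul_le_mul_left this hpos

/-- viscosity curve converges -/
lemma trigs_visc [CompleteSpace H] (f : H → ℝ) (hf : Continuous f)
    (xstar : H) (hxstar : ∀ y : H, f xstar ≤ f y)
    (hxstar_min : ∀ y : H, (∀ z : H, f y ≤ f z) → ‖xstar‖ ≤ ‖y‖)
    (xe : ℝ → H)
    (hst : ∀ ε, 0 < ε → ∀ u, f (xe ε) + ε / 2 * ‖xe ε‖ ^ 2 + ε / 2 * ‖u - xe ε‖ ^ 2 ≤
      f u + ε / 2 * ‖u‖ ^ 2) :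
    Tendsto xe (nhdsWithin 0 (Ioi 0)) (nhds xstar) := by
  have hs : ∀ ε, 0 < ε → ‖xstar - xe ε‖ ^ 2 ≤ ‖xstar‖ ^ 2 - ‖xe ε‖ ^ 2 := by
    intro ε hε
    refine trigs_ye_mono (xe ε) xstar ε 0 (f (xe ε)) (f xstar) le_rfl hε (hst ε hε xstar) ?_
    simpa using hxstar (xe ε)
  have hm : ∀ e2 e1, 0 < e2 → e2 ≤ e1 → ‖xe e2 - xe e1‖ ^ 2 ≤ ‖xe e2‖ ^ 2 - ‖xe e1‖ ^ 2 := by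
    intro e2 e1 h2 h12
    rcases h12.eq_or_lt with h | h
    · subst h; simp
    refine trigs_ye_mono (xe e1) (xe e2) e1 e2 (f (xe e1)) (f (xe e2)) h2.le h
      (hst e1 (h2.trans h) _) ?_
    have := hst e2 h2 (xe e1)
    nlinarith [mul_nonneg h2.le (sq_nonneg ‖xe e1 - xe e2‖)]
  set a : ℕ → ℝ := fun n => 1 / ((n : ℝ) + 1) with ha
  have hapos : ∀ n, 0 < a n := fun n => by simp only [ha]; positivity
  have haanti : ∀ m n, m ≤ n → a n ≤ a m := by
    intro m n hmn
    exact one_div_le_one_div_of_le (by positivity) (by gcongr)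
  have hmono : Monotone (fun n => ‖xe (a n)‖ ^ 2) := by
    intro m n hmn
    have := hm (a n) (a m) (hapos n) (haanti m n hmn)
    have h0 := sq_nonneg ‖xe (a n) - xe (a m)‖
    simp only
    linarith
  have hbdd : BddAbove (range (fun n => ‖xe (a n)‖ ^ 2)) := by
    refine ⟨‖xstar‖ ^ 2, ?_⟩
    rintro _ ⟨n, rfl⟩
    have := hs (a n) (hapos n)
    have h0 := sq_nonneg ‖xstar - xe (a n)‖
    simp only
    linarith
  have hlim := tendsto_atTop_ciSup hmono hbdd
  set ℓ := ⨆ n, ‖xe (a n)‖ ^ 2 with hℓ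
  have hcau : CauchySeq (fun n => xe (a n)) := by
    refine cauchySeq_of_le_tendsto_0' (fun n => Real.sqrt (ℓ - ‖xe (a n)‖ ^ 2)) ?_ ?_
    · intro m n hmn
      rw [dist_comm, dist_eq_norm]
      apply Real.le_sqrt_of_sq_le
      have := hm (a n) (a m) (hapos n) (haanti m n hmn)
      have h2 : ‖xe (a n)‖ ^ 2 ≤ ℓ := le_ciSup hbdd n
      linarith
    · have : Tendsto (fun n => Real.sqrt (ℓ - ‖xe (a n)‖ ^ 2)) atTop (nhds (Real.sqrt (ℓ - ℓ))) :=
        (tendsto_const_nhds.sub hlim).sqrt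
      simpa using this
  obtain ⟨yb, hyb⟩ := cauchySeq_tendsto_of_complete hcau
  have ha0 : Tendsto a atTop (nhds 0) := tendsto_one_div_add_atTop_nhds_zero_nat
  have hfy : f yb ≤ f xstar := by
    have h1 : Tendsto (fun n => f (xe (a n))) atTop (nhds (f yb)) :=
      (hf.tendsto yb).comp hyb
    have h2 : Tendsto (fun n => f xstar + a n / 2 * ‖xstar‖ ^ 2) atTop
        (nhds (f xstar + 0 / 2 * ‖xstar‖ ^ 2)) :=
      tendsto_const_nhds.add ((ha0.div_const 2).mul_const _)
    have h3 := le_of_tendsto_of_tendsto' h1 h2 (fun n => by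
      have := hst (a n) (hapos n) xstar
      have h4 := mul_nonneg (hapos n).le (sq_nonneg ‖xe (a n)‖)
      have h5 := mul_nonneg (hapos n).le (sq_nonneg ‖xstar - xe (a n)‖)
      linarith)
    simpa using h3
  have hyn : ‖xstar‖ ≤ ‖yb‖ := hxstar_min yb (fun z => hfy.trans (hxstar z))
  have hnn : Tendsto (fun n => ‖xe (a n)‖ ^ 2) atTop (nhds (‖yb‖ ^ 2)) := hyb.norm.pow 2
  rw [tendsto_iff_norm_sub_tendsto_zero]
  rw [Metric.tendsto_nhds]
  intro η hη
  have hev : ∀ᶠ n in atTop, ‖yb‖ ^ 2 - η ^ 2 < ‖xe (a n)‖ ^ 2 :=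
    hnn.eventually (lt_mem_nhds (by nlinarith [sq_nonneg η, pow_pos hη 2]))
  obtain ⟨n, hn⟩ := hev.exists
  filter_upwards [Ioc_mem_nhdsGT (hapos n)] with ε hε
  have h1 := hs ε hε.1
  have h2 := hm ε (a n) hε.1 hε.2
  have h3 := sq_nonneg ‖xe ε - xe (a n)‖
  have h4 : ‖xstar‖ ^ 2 ≤ ‖yb‖ ^ 2 := pow_le_pow_left₀ (norm_nonneg _) hyn 2
  rw [dist_zero_right, norm_norm, norm_sub_rev]
  exact lt_of_pow_lt_pow_left₀ 2 hη.le (by linarith)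

/-- main energy estimate -/
lemma trigs_energy_rate [CompleteSpace H]
    (f : H → ℝ) (f' : H → H)
    (hgrad : ∀ x : H, HasGradientAt f (f' x) x)
    (hgi : ∀ w u, f w + inner ℝ (f' w) (u - w) ≤ f u)
    (N : ℝ)
    (xe : ℝ → H) (hxe : ∀ ε : ℝ, 0 < ε → f' (xe ε) + ε • xe ε = 0)
    (hN : ∀ ε, 0 < ε → ‖xe ε‖ ≤ N)
    (hst : ∀ ε, 0 < ε → ∀ u, f (xe ε) + ε / 2 * ‖xe ε‖ ^ 2 + ε / 2 * ‖u - xe ε‖ ^ 2 ≤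
      f u + ε / 2 * ‖u‖ ^ 2)
    (r t₀ : ℝ) (hr : 0 < r) (hr2 : r < 2) (ht₀ : 0 < t₀)
    (e : ℝ → ℝ) (he : ∀ t : ℝ, e t = t ^ (-r))
    (hxe_diff : ∀ t ∈ Set.Ici t₀, DifferentiableAt ℝ (fun s => xe (e s)) t)
    (δ lam : ℝ) (hlam : 0 < lam) (hlam₂ : lam < δ) (hα : lam * (δ - lam) ≤ 1)
    (x x' x'' : ℝ → H)
    (hx' : ∀ t : ℝ, HasDerivAt x (x' t) t)
    (hx'' : ∀ t : ℝ, HasDerivAt x' (x'' t) t)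
    (hODE : ∀ t : ℝ, t₀ ≤ t →
      x'' t + (δ * t ^ (-(r / 2))) • x' t + f' (x t) + (t ^ (-r)) • x t = 0)
    (E : ℝ → ℝ)
    (hE : ∀ t : ℝ, E t =
      (f (x t) + (e t / 2) * ‖x t‖ ^ 2) - (f (xe (e t)) + (e t / 2) * ‖xe (e t)‖ ^ 2) +
      (1 / 2) * ‖(lam * Real.sqrt (e t)) • (x t - xe (e t)) + x' t‖ ^ 2) :
    ∃ M T : ℝ, 0 < M ∧ 0 < T ∧ ∀ t, T ≤ t → E t ≤ M * t ^ (-((r + 2) / 2)) := by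
  have hd : 0 < δ - lam := by linarith
  have hN0 : 0 ≤ N := (norm_nonneg _).trans (hN 1 one_pos)
  obtain ⟨κ, hκ, hκ1, hκ2⟩ : ∃ κ : ℝ, 0 < κ ∧ lam * r * κ ≤ lam / 8 ∧
      lam * r * κ ≤ (δ - lam) / 3 := by
    have hm : 0 < min (lam / 8) ((δ - lam) / 3) := lt_min (by positivity) (by positivity)
    refine ⟨min (lam / 8) ((δ - lam) / 3) / (lam * r), by positivity, ?_, ?_⟩ <;>
      rw [mul_div_cancel₀ _ (by positivity)]
    · exact min_le_left _ _
    · exact min_le_right _ _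
  obtain ⟨K, hK0, hK1, hK2, hK3⟩ : ∃ K : ℝ, 0 < K ∧ K ≤ lam ∧ K * lam ≤ 1 / 16 ∧
      K ≤ (δ - lam) / 6 := by
    refine ⟨min lam (min (1 / 16 / lam) ((δ - lam) / 6)), ?_, min_le_left _ _, ?_, ?_⟩
    · refine lt_min hlam (lt_min (by positivity) (by positivity))
    · rw [← le_div_iff₀ hlam]
      exact (min_le_right _ _).trans (min_le_left _ _)
    · exact (min_le_right _ _).trans (min_le_right _ _)
  -- the scale functions
  set s : ℝ → ℝ := fun t => t ^ (-(r / 2)) with hs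
  have hspos : ∀ t, 0 < t → 0 < s t := fun t ht => Real.rpow_pos_of_pos ht _
  have hes : ∀ t, 0 < t → e t = s t ^ 2 := by
    intro t ht
    simp only [hs]
    rw [he, ← Real.rpow_natCast, ← Real.rpow_mul ht.le]
    congr 1; push_cast; ring
  have hepos : ∀ t, 0 < t → 0 < e t := fun t ht => by
    rw [he]; exact Real.rpow_pos_of_pos ht _
  have hsd : ∀ t, 0 < t → HasDerivAt s (-(r / 2) * s t * t⁻¹) t := by
    intro t ht
    have := Real.hasDerivAt_rpow_const (x := t) (p := -(r / 2)) (Or.inl ht.ne')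
    convert this using 1
    rw [Real.rpow_sub_one ht.ne']
    simp only [hs]
    ring
  have hed : ∀ t, 0 < t → HasDerivAt e (-r * e t * t⁻¹) t := by
    intro t ht
    have := Real.hasDerivAt_rpow_const (x := t) (p := -r) (Or.inl ht.ne')
    have h2 : e = fun t => t ^ (-r) := funext he
    rw [h2]
    convert this using 1
    rw [Real.rpow_sub_one ht.ne']
    ring
  -- the curve y
  set y : ℝ → H := fun t => xe (e t) with hy
  set q : ℝ → H := fun t => deriv y t with hq
  have hyd : ∀ t, t₀ ≤ t → HasDerivAt y (q t) t := fun t ht => (hxe_diff t ht).hasDerivAt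
  have hqb : ∀ t, t₀ ≤ t → ‖q t‖ ≤ 2 * r * (2 * N) * t⁻¹ := by
    intro t ht
    have htp : 0 < t := ht₀.trans_le ht
    have hne : -r * e t * t⁻¹ ≠ 0 := by
      have := hepos t htp
      have : 0 < r * e t * t⁻¹ := by positivity
      intro h; linarith
    have := trigs_yderiv y e (q t) _ (2 * N) t (hed t htp) hne (hyd t ht) (hepos t htp)
      (by positivity) (by
        filter_upwards [lt_mem_nhds htp] with u hu
        exact trigs_ye_lip (y t) (y u) (e t) (e u) (f (y t)) (f (y u)) N (hepos t htp) (hepos u hu)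
          (hst _ (hepos t htp) _) (hst _ (hepos u hu) _) (hN _ (hepos t htp)) (hN _ (hepos u hu)))
    refine this.trans (le_of_eq ?_)
    have h1 := hepos t htp
    rw [show -r * e t * t⁻¹ = -(r * e t * t⁻¹) by ring, abs_neg,
      abs_of_pos (by positivity : 0 < r * e t * t⁻¹)]
    field_simp
  -- derivative of the energy
  set z : ℝ → H := fun t => x t - y t with hz
  set g : ℝ → H := fun t => f' (x t) + e t • x t with hg
  set v' : ℝ → H := fun t => (lam * (-(r / 2) * s t * t⁻¹)) • z t + (lam * s t) • (x' t - q t)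
    - (δ * s t) • x' t - g t with hv'
  set D : ℝ → ℝ := fun t => (-r * e t * t⁻¹) / 2 * (‖x t‖ ^ 2 - ‖y t‖ ^ 2) + (inner ℝ (g t) (x' t) +
    inner ℝ ((lam * s t) • z t + x' t) (v' t)) with hD
  have hED : ∀ t, t₀ ≤ t → HasDerivAt E (D t) t := by
    intro t ht
    have htp : 0 < t := ht₀.trans_le ht
    have hEE : E =ᶠ[nhds t] fun t => (f (x t) + (e t / 2) * ‖x t‖ ^ 2) -
        (f (y t) + (e t / 2) * ‖y t‖ ^ 2) + (1 / 2) * ‖(lam * s t) • z t + x' t‖ ^ 2 := by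
      filter_upwards [lt_mem_nhds htp] with u hu
      rw [hE u]
      have : Real.sqrt (e u) = s u := by
        rw [hes u hu, Real.sqrt_sq (hspos u hu).le]
      rw [this]
    have d1 : HasDerivAt (fun t => f (x t)) (inner ℝ (f' (x t)) (x' t)) t := by
      exact (hgrad (x t)).hasFDerivAt.comp_hasDerivAt t (hx' t)
    have d2 : HasDerivAt (fun t => f (y t)) (inner ℝ (f' (y t)) (q t)) t := by
      exact (hgrad (y t)).hasFDerivAt.comp_hasDerivAt t (hyd t ht)
    have d3 := ((hed t htp).div_const 2).mul (hx' t).norm_sq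
    have d4 := ((hed t htp).div_const 2).mul (hyd t ht).norm_sq
    have d5 := ((((hsd t htp).const_mul lam).smul ((hx' t).sub (hyd t ht))).add
      (hx'' t)).norm_sq.const_mul (1 / 2 : ℝ)
    have d6 := ((d1.add d3).sub (d2.add d4)).add d5
    refine HasDerivAt.congr_of_eventuallyEq ?_ hEE
    refine HasDerivAt.congr_deriv d6 ?_
    have hyz : f' (y t) = -(e t • y t) := eq_neg_of_add_eq_zero_left (hxe _ (hepos t htp))
    have hxx : x'' t = -((δ * s t) • x' t) - g t := by
      have := hODE t ht
      rw [← he] at this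
      have h2 : x'' t = -((δ * s t) • x' t) - (f' (x t) + e t • x t) +
        (x'' t + (δ * s t) • x' t + f' (x t) + e t • x t) := by abel
      rw [h2]
      simp only [hs, hg]
      rw [this, add_zero]
    have hvv : (lam * s t) • (x' t - q t) + (lam * (-(r / 2) * s t * t⁻¹)) • (x t - y t) + x'' t =
        v' t := by
      rw [hxx]; simp only [hv', hz]; abel
    simp only [hD, Pi.add_apply, Pi.sub_apply, Pi.smul_apply, Pi.mul_apply, Pi.smul_apply'] at *
    rw [hvv, hyz]
    simp only [hg, hz, inner_add_left _ _ (x' t), inner_neg_left, real_inner_smul_left]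
    ring
  -- positivity
  have hGnn : ∀ t, 0 < t → 0 ≤ (f (x t) + (e t / 2) * ‖x t‖ ^ 2) -
        (f (y t) + (e t / 2) * ‖y t‖ ^ 2) := by
    intro t ht
    have h1 := hst _ (hepos t ht) (x t)
    have h2 := mul_nonneg (hepos t ht).le (sq_nonneg ‖x t - xe (e t)‖)
    simp only [hy]
    linarith
  have hEnn : ∀ t, 0 < t → 0 ≤ E t := by
    intro t ht
    rw [hE]
    have := hGnn t ht
    have h2 := sq_nonneg ‖(lam * Real.sqrt (e t)) • (x t - xe (e t)) + x' t‖
    simp only [hy] at this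
    linarith
  set C : ℝ := (8 * lam ^ 3 + 3 * lam ^ 2 / (δ - lam)) * (2 * r * (2 * N)) ^ 2 * κ + r / 2 * N ^ 2
    with hC
  have hC0 : 0 ≤ C := by positivity
  have hDb : ∀ t, t₀ ≤ t → t⁻¹ ≤ κ * s t → D t ≤ - K * s t * E t + C * (s t ^ 2 * t⁻¹) := by
    intro t ht hts
    have htp : 0 < t := ht₀.trans_le ht
    have hb := trigs_energy_bound (z t) (x' t) (q t) (g t) lam δ r κ K (s t) t⁻¹ (2 * N)
      ((f (x t) + (e t / 2) * ‖x t‖ ^ 2) - (f (y t) + (e t / 2) * ‖y t‖ ^ 2)) hlam hlam₂ hα hr hκ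
      hκ1 hκ2 hK0 hK1 hK2 hK3 (hspos t htp) (by positivity) hts (hGnn t htp) (by positivity)
      (hqb t ht) (by
        rw [← hes t htp]
        exact trigs_strong2 (y t) (x t) (e t) (f (y t)) (f (x t)) (f' (x t)) (hgi _ _))
    have hEt : E t = (f (x t) + (e t / 2) * ‖x t‖ ^ 2) - (f (y t) + (e t / 2) * ‖y t‖ ^ 2) +
        1 / 2 * ‖(lam * s t) • z t + x' t‖ ^ 2 := by
      rw [hE, hes t htp, Real.sqrt_sq (hspos t htp).le, ← hes t htp]
    rw [← hEt] at hb
    have h1 : (-r * e t * t⁻¹) / 2 * (‖x t‖ ^ 2 - ‖y t‖ ^ 2) ≤ r / 2 * N ^ 2 * (s t ^ 2 * t⁻¹) := by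
      rw [hes t htp]
      have hyN : ‖y t‖ ^ 2 ≤ N ^ 2 := pow_le_pow_left₀ (norm_nonneg _) (hN _ (hepos t htp)) 2
      have h2 : ‖y t‖ ^ 2 - ‖x t‖ ^ 2 ≤ N ^ 2 := by linarith [sq_nonneg ‖x t‖]
      have h3 : 0 ≤ r / 2 * (s t ^ 2 * t⁻¹) := by positivity
      have := mul_le_mul_of_nonneg_left h2 h3
      linarith
    simp only [hD, hv', hC]
    linarith
  -- choose T
  set p : ℝ := r / 2 + 1 with hp
  have hp0 : 0 < p := by positivity
  have hκ' : 0 < min κ (K / (2 * p)) := lt_min hκ (by positivity)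
  have hev : ∀ᶠ t : ℝ in atTop, t ^ (-(1 - r / 2)) ≤ min κ (K / (2 * p)) :=
    (tendsto_rpow_neg_atTop (by linarith : 0 < 1 - r / 2)).eventually (ge_mem_nhds hκ')
  obtain ⟨T1, hT1⟩ := eventually_atTop.1 hev
  set T := max T1 t₀ with hT
  have hTt : ∀ t, T ≤ t → t₀ ≤ t := fun t ht => (le_max_right _ _).trans ht
  have hTp : 0 < T := ht₀.trans_le (le_max_right _ _)
  have hinv : ∀ t, T ≤ t → t⁻¹ ≤ κ * s t ∧ p * t⁻¹ ≤ K / 2 * s t := by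
    intro t ht
    have htp : 0 < t := hTp.trans_le ht
    have h1 := hT1 t ((le_max_left _ _).trans ht)
    have h2 : t⁻¹ = t ^ (-(1 - r / 2)) * s t := by
      simp only [hs]
      rw [← Real.rpow_add htp, ← Real.rpow_neg_one]
      congr 1; ring
    have hsp := hspos t htp
    constructor
    · rw [h2]; gcongr; exact h1.trans (min_le_left _ _)
    · rw [h2, ← mul_assoc]
      gcongr
      calc p * t ^ (-(1 - r / 2)) ≤ p * (K / (2 * p)) := by
            gcongr; exact h1.trans (min_le_right _ _)
        _ = K / 2 := by field_simp
  set W : ℝ → ℝ := fun t => t ^ p * E t with hW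
  have hWd : ∀ t, T ≤ t → HasDerivAt W (p * t ^ (p - 1) * E t + t ^ p * D t) t := by
    intro t ht
    have htp : 0 < t := hTp.trans_le ht
    exact (Real.hasDerivAt_rpow_const (Or.inl htp.ne')).mul (hED t (hTt t ht))
  set M := max (W T) (2 * C / K + 1) with hM
  have hMpos : 0 < M := lt_of_lt_of_le (by positivity) (le_max_right _ _)
  have hWM := trigs_gronwall W _ T M hWd (le_max_left _ _) (by
    intro t ht hWt
    have htp : 0 < t := hTp.trans_le ht
    obtain ⟨i1, i2⟩ := hinv t ht
    have hb := hDb t (hTt t ht) i1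
    have htpp : 0 < t ^ p := Real.rpow_pos_of_pos htp _
    have hsp := hspos t htp
    have h1 : t ^ p * (s t ^ 2 * t⁻¹) = s t := by
      rw [← hes t htp, he, ← Real.rpow_neg_one, ← Real.rpow_add htp, ← Real.rpow_add htp]
      simp only [hs, hp]
      congr 1; ring
    have h2 : p * t ^ (p - 1) * E t = p * t⁻¹ * W t := by
      rw [Real.rpow_sub_one htp.ne']; simp only [hW]; ring
    have h3 : t ^ p * D t ≤ - K * s t * W t + C * s t := by
      calc t ^ p * D t ≤ t ^ p * (- K * s t * E t + C * (s t ^ 2 * t⁻¹)) := by gcongr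
        _ = - K * s t * W t + C * (t ^ p * (s t ^ 2 * t⁻¹)) := by simp only [hW]; ring
        _ = _ := by rw [h1]
    have h4 : p * t⁻¹ * W t ≤ K / 2 * s t * W t := by
      rw [hWt]; gcongr
    have h5 : 2 * C / K < M := lt_of_lt_of_le (by linarith) (le_max_right _ _)
    have h6 : C < K / 2 * M := by
      rw [div_lt_iff₀ hK0] at h5; linarith
    have h7 := mul_lt_mul_of_pos_right h6 hsp
    rw [h2]
    rw [hWt] at h3 h4 ⊢
    linarith)
  refine ⟨M, T, hMpos, hTp, fun t ht => ?_⟩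
  have htp : 0 < t := hTp.trans_le ht
  have htpp : 0 < t ^ p := Real.rpow_pos_of_pos htp _
  have := hWM t ht
  simp only [hW] at this
  rw [show -((r + 2) / 2) = -p by simp only [hp]; ring, Real.rpow_neg htp.le, ← div_eq_mul_inv,
    le_div_iff₀ htpp]
  linarith

end TrigsAux

/-- Deterministic convergence rates for TRIGS with `ε(t) = t^{−r}` (Theorem 3.2 of the
paper with zero diffusion): along a solution `x` of
`ẍ(t) + δt^{−r/2}ẋ(t) + ∇f(x(t)) + t^{−r}x(t) = 0`, the energy satisfies
`𝓔(t, x(t), ẋ(t)) = O(t^{−(r+2)/2})`; consequently `f(x(t)) − inf f = O(t^{−r})`,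
`‖x(t) − x_{ε(t)}‖² = O(t^{−(2−r)/2})`, `‖ẋ(t)‖ = O(t^{−(r+2)/4})` if `r ∈ [2/3, 2)`,
`‖ẋ(t)‖ = O(t^{−r})` if `r ∈ (0, 2/3)`, and `x(t) → x*` strongly. -/
theorem trigs_convergence_rates
    {H : Type*} [NormedAddCommGroup H] [InnerProductSpace ℝ H] [CompleteSpace H]
    (f : H → ℝ) (f' : H → H) (L : ℝ) (hL : 0 < L)
    (hconv : ConvexOn ℝ Set.univ f)
    (hgrad : ∀ x : H, HasGradientAt f (f' x) x)
    (hlip : ∀ x y : H, ‖f' x - f' y‖ ≤ L * ‖x - y‖)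
    (xstar : H) (hxstar : ∀ y : H, f xstar ≤ f y)
    (hxstar_min : ∀ y : H, (∀ z : H, f y ≤ f z) → ‖xstar‖ ≤ ‖y‖)
    (xe : ℝ → H) (hxe : ∀ ε : ℝ, 0 < ε → f' (xe ε) + ε • xe ε = 0)
    (r t₀ : ℝ) (hr : 0 < r) (hr2 : r < 2) (ht₀ : 0 < t₀)
    (e : ℝ → ℝ) (he : ∀ t : ℝ, e t = t ^ (-r))
    (hxe_diff : ∀ t ∈ Set.Ici t₀, DifferentiableAt ℝ (fun s => xe (e s)) t)
    (δ a c lam : ℝ) (hδ : 0 < δ) (ha : 1 < a) (hc : 2 < c)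
    (hlam₁ : δ / 2 < lam) (hlam₂ : lam < δ) (hlam₃ : lam < a * δ / (a + 1))
    (hC : (δ + 1 / c) * lam - lam ^ 2 - 1 ≤ 0)
    (x x' x'' : ℝ → H)
    (hx' : ∀ t : ℝ, HasDerivAt x (x' t) t)
    (hx'' : ∀ t : ℝ, HasDerivAt x' (x'' t) t)
    (hODE : ∀ t : ℝ, t₀ ≤ t →
      x'' t + (δ * t ^ (-(r / 2))) • x' t + f' (x t) + (t ^ (-r)) • x t = 0)
    (E : ℝ → ℝ)
    (hE : ∀ t : ℝ, E t =
      (f (x t) + (e t / 2) * ‖x t‖ ^ 2) - (f (xe (e t)) + (e t / 2) * ‖xe (e t)‖ ^ 2) +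
      (1 / 2) * ‖(lam * Real.sqrt (e t)) • (x t - xe (e t)) + x' t‖ ^ 2) :
    (fun t : ℝ => E t) =O[atTop] (fun t : ℝ => t ^ (-((r + 2) / 2))) ∧
    (fun t : ℝ => f (x t) - ⨅ z : H, f z) =O[atTop] (fun t : ℝ => t ^ (-r)) ∧
    (fun t : ℝ => ‖x t - xe (e t)‖ ^ 2) =O[atTop] (fun t : ℝ => t ^ (-((2 - r) / 2))) ∧
    ((2 / 3 : ℝ) ≤ r → (fun t : ℝ => ‖x' t‖) =O[atTop] (fun t : ℝ => t ^ (-((r + 2) / 4)))) ∧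
    (r < (2 / 3 : ℝ) → (fun t : ℝ => ‖x' t‖) =O[atTop] (fun t : ℝ => t ^ (-r))) ∧
    Tendsto x atTop (nhds xstar) := by
  have hgi := trigs_grad_ineq f f' hconv hgrad
  have hst : ∀ ε, 0 < ε → ∀ u, f (xe ε) + ε / 2 * ‖xe ε‖ ^ 2 + ε / 2 * ‖u - xe ε‖ ^ 2 ≤
      f u + ε / 2 * ‖u‖ ^ 2 := fun ε hε u =>
    trigs_strong (xe ε) u ε (f (xe ε)) (f u) (f' (xe ε)) (hxe ε hε) (hgi _ _)
  have hN : ∀ ε, 0 < ε → ‖xe ε‖ ≤ ‖xstar‖ := by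
    intro ε hε
    have h := trigs_ye_mono (xe ε) xstar ε 0 (f (xe ε)) (f xstar) le_rfl hε (hst ε hε xstar)
      (by simpa using hxstar (xe ε))
    have h2 := sq_nonneg ‖xstar - xe ε‖
    exact le_of_sq_le_sq (by linarith) (norm_nonneg _)
  have hlam : 0 < lam := by linarith
  have hα : lam * (δ - lam) ≤ 1 := by
    have : 0 < 1 / c * lam := by
      have : 0 < c := by linarith
      positivity
    nlinarith
  have hfc : Continuous f :=
    continuous_iff_continuousAt.2 fun u => (hgrad u).hasFDerivAt.continuousAt
  obtain ⟨M, T, hM, hT, hEM⟩ := trigs_energy_rate f f' hgrad hgi ‖xstar‖ xe hxe hN hst r t₀ hr hr2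
    ht₀ e he hxe_diff δ lam hlam hlam₂ hα x x' x'' hx' hx'' hODE E hE
  have hepos : ∀ t, 0 < t → 0 < e t := fun t ht => by
    rw [he]; exact Real.rpow_pos_of_pos ht _
  have hE1 : ∀ t, 0 < t → e t / 2 * ‖x t - xe (e t)‖ ^ 2 ≤ E t := by
    intro t ht
    rw [hE]
    have h1 := hst _ (hepos t ht) (x t)
    have h2 := sq_nonneg ‖(lam * Real.sqrt (e t)) • (x t - xe (e t)) + x' t‖
    linarith
  have hEnn : ∀ t, 0 < t → 0 ≤ E t := fun t ht => le_trans (by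
    have := hepos t ht
    positivity) (hE1 t ht)
  have hE2 : ∀ t, 0 < t → ‖(lam * Real.sqrt (e t)) • (x t - xe (e t)) + x' t‖ ^ 2 ≤ 2 * E t := by
    intro t ht
    rw [hE]
    have h1 := hst _ (hepos t ht) (x t)
    have h2 := mul_nonneg (hepos t ht).le (sq_nonneg ‖x t - xe (e t)‖)
    linarith
  have hmin : ⨅ w : H, f w = f xstar := by
    apply le_antisymm
    · exact ciInf_le ⟨f xstar, by rintro _ ⟨w, rfl⟩; exact hxstar w⟩ xstar
    · exact le_ciInf hxstar
  have hz : ∀ t, T ≤ t → ‖x t - xe (e t)‖ ^ 2 ≤ 2 * M * t ^ (-((2 - r) / 2)) := by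
    intro t ht
    have htp : 0 < t := hT.trans_le ht
    have h1 := (hE1 t htp).trans (hEM t ht)
    have h2 : t ^ (-((r + 2) / 2)) = e t * t ^ (-((2 - r) / 2)) := by
      rw [he, ← Real.rpow_add htp]; congr 1; ring
    rw [h2] at h1
    have h3 := hepos t htp
    refine le_of_mul_le_mul_left ?_ h3
    linarith
  have hv : ∀ t, T ≤ t → ‖x' t‖ ≤ (1 + lam) * Real.sqrt (2 * M) * t ^ (-((r + 2) / 4)) := by
    intro t ht
    have htp : 0 < t := hT.trans_le ht
    have hsq : Real.sqrt (2 * E t) ≤ Real.sqrt (2 * M) * t ^ (-((r + 2) / 4)) := by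
      have h0 : t ^ (-((r + 2) / 2)) = (t ^ (-((r + 2) / 4))) ^ 2 := by
        rw [← Real.rpow_natCast, ← Real.rpow_mul htp.le]; congr 1; push_cast; ring
      have hp : 0 ≤ t ^ (-((r + 2) / 4)) := Real.rpow_nonneg htp.le _
      calc Real.sqrt (2 * E t) ≤ Real.sqrt (2 * M * (t ^ (-((r + 2) / 4))) ^ 2) := by
            apply Real.sqrt_le_sqrt
            have := hEM t ht
            rw [h0] at this
            linarith
        _ = _ := by rw [Real.sqrt_mul (by positivity), Real.sqrt_sq hp]
    have h1 : ‖(lam * Real.sqrt (e t)) • (x t - xe (e t)) + x' t‖ ≤ Real.sqrt (2 * E t) :=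
      Real.le_sqrt_of_sq_le (hE2 t htp)
    have h2 : Real.sqrt (e t) * ‖x t - xe (e t)‖ ≤ Real.sqrt (2 * E t) := by
      apply Real.le_sqrt_of_sq_le
      rw [mul_pow, Real.sq_sqrt (hepos t htp).le]
      linarith [hE1 t htp]
    have h3 : ‖x' t‖ ≤ ‖(lam * Real.sqrt (e t)) • (x t - xe (e t)) + x' t‖ +
        ‖(lam * Real.sqrt (e t)) • (x t - xe (e t))‖ := by
      have := norm_sub_le ((lam * Real.sqrt (e t)) • (x t - xe (e t)) + x' t)
        ((lam * Real.sqrt (e t)) • (x t - xe (e t)))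
      simpa using this
    rw [norm_smul (lam * Real.sqrt (e t)), Real.norm_of_nonneg (by positivity)] at h3
    have h4 : lam * Real.sqrt (e t) * ‖x t - xe (e t)‖ ≤ lam * Real.sqrt (2 * E t) := by
      rw [mul_assoc]; gcongr
    calc ‖x' t‖ ≤ (1 + lam) * Real.sqrt (2 * E t) := by linarith
      _ ≤ (1 + lam) * (Real.sqrt (2 * M) * t ^ (-((r + 2) / 4))) := by gcongr
      _ = _ := by ring
  have hVO : (fun t : ℝ => ‖x' t‖) =O[atTop] (fun t : ℝ => t ^ (-((r + 2) / 4))) := by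
    refine IsBigO.of_bound ((1 + lam) * Real.sqrt (2 * M)) ?_
    filter_upwards [eventually_ge_atTop T] with t ht
    have htp : 0 < t := hT.trans_le ht
    rw [norm_norm, Real.norm_of_nonneg (Real.rpow_nonneg htp.le _)]
    exact hv t ht
  have hpow : ∀ p q : ℝ, p ≤ q →
      (fun t : ℝ => t ^ p) =O[atTop] (fun t : ℝ => t ^ q) := by
    intro p q hpq
    refine IsBigO.of_bound 1 ?_
    filter_upwards [eventually_ge_atTop 1] with t ht
    have htp : 0 < t := one_pos.trans_le ht
    rw [Real.norm_of_nonneg (Real.rpow_nonneg htp.le _),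
      Real.norm_of_nonneg (Real.rpow_nonneg htp.le _), one_mul]
    exact Real.rpow_le_rpow_of_exponent_le ht hpq
  refine ⟨?_, ?_, ?_, fun _ => hVO, fun h => hVO.trans (hpow _ _ (by linarith)), ?_⟩
  · refine IsBigO.of_bound M ?_
    filter_upwards [eventually_ge_atTop T] with t ht
    have htp : 0 < t := hT.trans_le ht
    rw [Real.norm_of_nonneg (hEnn t htp), Real.norm_of_nonneg (Real.rpow_nonneg htp.le _)]
    exact hEM t ht
  · rw [hmin]
    refine IsBigO.of_bound (M + ‖xstar‖ ^ 2 / 2) ?_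
    filter_upwards [eventually_ge_atTop T, eventually_ge_atTop 1] with t ht ht1
    have htp : 0 < t := hT.trans_le ht
    have hle := hxstar (x t)
    rw [Real.norm_of_nonneg (by linarith), Real.norm_of_nonneg (Real.rpow_nonneg htp.le _)]
    have h1 := hEM t ht
    have h2 : t ^ (-((r + 2) / 2)) ≤ t ^ (-r) :=
      Real.rpow_le_rpow_of_exponent_le ht1 (by linarith)
    have h3 := mul_le_mul_of_nonneg_left h2 hM.le
    have h4 := hst _ (hepos t htp) xstar
    have h5 := mul_nonneg (hepos t htp).le (sq_nonneg ‖xstar - xe (e t)‖)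
    have h6 := mul_nonneg (hepos t htp).le (sq_nonneg ‖x t‖)
    have h7 := sq_nonneg ‖(lam * Real.sqrt (e t)) • (x t - xe (e t)) + x' t‖
    rw [hE] at h1
    rw [← he] at h3 ⊢
    linarith
  · refine IsBigO.of_bound (2 * M) ?_
    filter_upwards [eventually_ge_atTop T] with t ht
    have htp : 0 < t := hT.trans_le ht
    rw [Real.norm_of_nonneg (by positivity), Real.norm_of_nonneg (Real.rpow_nonneg htp.le _)]
    exact hz t ht
  · have he0 : Tendsto e atTop (nhdsWithin 0 (Ioi 0)) := by
      rw [tendsto_nhdsWithin_iff]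
      refine ⟨?_, ?_⟩
      · have : e = fun t => t ^ (-r) := funext he
        rw [this]; exact tendsto_rpow_neg_atTop hr
      · filter_upwards [eventually_gt_atTop 0] with t ht using hepos t ht
    have hy := (trigs_visc f hfc xstar hxstar hxstar_min xe hst).comp he0
    have hd : Tendsto (fun t => ‖x t - xe (e t)‖ ^ 2) atTop (nhds 0) := by
      have h0 : Tendsto (fun t : ℝ => 2 * M * t ^ (-((2 - r) / 2))) atTop (nhds (2 * M * 0)) :=
        (tendsto_rpow_neg_atTop (by linarith : 0 < (2 - r) / 2)).const_mul _
      rw [mul_zero] at h0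
      refine squeeze_zero' (Eventually.of_forall fun t => by positivity) ?_ h0
      filter_upwards [eventually_ge_atTop T] with t ht using hz t ht
    have hd2 : Tendsto (fun t => ‖x t - xe (e t)‖) atTop (nhds 0) := by
      have := hd.sqrt
      simpa [Real.sqrt_sq] using this
    have hd3 : Tendsto (fun t => x t - xe (e t)) atTop (nhds 0) :=
      tendsto_zero_iff_norm_tendsto_zero.2 hd2
    have := hd3.add hy
    simpa using this
end
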